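/- Let K be a compact subset of (0,2). There exists C > 0 such that for all α ∈ K, all w ∈ (0, 1/3] and all y ∈ ℝ: (i) (1/C)(φ(y) + w^α ψ_α^{(0)}(y)) ≤ f_α(y,w) ≤ C(φ(y) + w^α ψ_α^{(0)}(y)); (ii) |g_α(y,w)| ≤ C ln(1/w) (φ(y) + w^α ψ_α^{(0)}(y)); (iii) |h_α(y,w)| ≤ C w^α ψ_α^{(0)}(y); (iv) |k_α(y,w)| ≤ C w^α ln(1/w) ψ_α^{(1)}(y). -/

import Mathlib

open MeasureTheory Filter Set Topology Matrix

noncomputable section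

namespace LevyLAN

/-- Standard Gaussian density `φ`. -/
def gauss (y : ℝ) : ℝ := (Real.sqrt (2 * Real.pi))⁻¹ * Real.exp (-(y ^ 2) / 2)

/-- Symmetric `α`-stable density `φ_α`, defined by Fourier inversion. -/
def stableDensity (α z : ℝ) : ℝ :=
  (2 * Real.pi)⁻¹ * ∫ u : ℝ, Real.cos (z * u) * Real.exp (-(|u| ^ α))

/-- `∂_α φ_α`. -/
def stableDensityDalpha (α z : ℝ) : ℝ :=
  -(2 * Real.pi)⁻¹ * ∫ u : ℝ, Real.cos (z * u) * |u| ^ α * Real.log |u| * Real.exp (-(|u| ^ α))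

/-- The operator `(D f) y = (y * f y)' = f y + y * f' y`. -/
def Dop (f : ℝ → ℝ) (y : ℝ) : ℝ := f y + y * deriv f y

/-- `f_α(y, w)`. -/
def fFun (α y w : ℝ) : ℝ := ∫ z : ℝ, gauss (y - w * z) * stableDensity α z

/-- `g_α(y, w)`. -/
def gFun (α y w : ℝ) : ℝ := ∫ z : ℝ, Dop gauss (y - w * z) * stableDensity α z

/-- `h_α(y, w)`. -/
def hFun (α y w : ℝ) : ℝ := ∫ z : ℝ, gauss (y - w * z) * Dop (stableDensity α) z

/-- `k_α(y, w)`. -/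
def kFun (α y w : ℝ) : ℝ := ∫ z : ℝ, gauss (y - w * z) * stableDensityDalpha α z

/-- `c_α`. -/
def cAlpha (α : ℝ) : ℝ :=
  if α = 1 then 1 / Real.pi
  else -(α * (α - 1)) / (2 * Real.Gamma (2 - α) * Real.cos (Real.pi * α / 2))

/-- `w_n(θ) = n^{1/2 - 1/α} δ / σ`. -/
def wn (n : ℕ) (σ δ α : ℝ) : ℝ := (n : ℝ) ^ ((1 : ℝ) / 2 - 1 / α) * δ / σ

/-- `l_α(y, w)` (it depends on `n`). -/
def lFun (n : ℕ) (α y w : ℝ) : ℝ :=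
  ((Real.log n - Real.log (Real.log n)) / (2 * α) - Real.log n / α ^ 2) * hFun α y w
    + kFun α y w

def kappa0 (σ δ α : ℝ) : ℝ := 2 * cAlpha α / (α * (2 - α) ^ (α / 2)) * (δ / σ) ^ α

def kappa1 (σ δ α : ℝ) : ℝ :=
  Real.log (δ / σ) + deriv cAlpha α / cAlpha α - Real.log (2 - α) / 2 - 1 / α

/-- The density `p_{1/n}(y, θ)`, with parameter `θ = (σ, δ, α) : Fin 3 → ℝ`. -/
def pdens (n : ℕ) (θ : Fin 3 → ℝ) (y : ℝ) : ℝ :=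
  Real.sqrt n / θ 0 * fFun (θ 2) (Real.sqrt n * y / θ 0) (wn n (θ 0) (θ 1) (θ 2))

/-- The log-likelihood `ln L_n(θ)`. -/
def logLik (n : ℕ) (θ : Fin 3 → ℝ) (x : Fin n → ℝ) : ℝ :=
  ∑ i, Real.log (pdens n θ (x i))

/-- Partial derivative in the `j`-th parameter coordinate. -/
def pderiv (j : Fin 3) (F : (Fin 3 → ℝ) → ℝ) (θ : Fin 3 → ℝ) : ℝ :=
  deriv (fun t => F (Function.update θ j t)) (θ j)

/-- The score `G_n(θ) = ∇_θ ln L_n(θ)`. -/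
def scoreVec (n : ℕ) (θ : Fin 3 → ℝ) (x : Fin n → ℝ) : Fin 3 → ℝ :=
  fun j => pderiv j (fun θ' => logLik n θ' x) θ

/-- The Hessian matrix `J_n(θ)` of the log-likelihood. -/
def hessMat (n : ℕ) (θ : Fin 3 → ℝ) (x : Fin n → ℝ) : Matrix (Fin 3) (Fin 3) ℝ :=
  Matrix.of fun i j => pderiv i (fun θ' => pderiv j (fun θ'' => logLik n θ'' x) θ') θ

def rate (n : ℕ) (α : ℝ) : ℝ := Real.log n ^ (α / 4) / (n : ℝ) ^ (α / 4)

/-- The rate matrix `u_n(θ)`. -/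
def un (n : ℕ) (θ : Fin 3 → ℝ) : Matrix (Fin 3) (Fin 3) ℝ :=
  !![1 / Real.sqrt n, 0, 0;
     0, rate n (θ 2), -(rate n (θ 2) * (θ 1 / (2 * θ 2)) * (Real.log n - Real.log (Real.log n)));
     0, 0, rate n (θ 2)]

/-- The information matrix `I(θ)`. -/
def Imat (θ : Fin 3 → ℝ) : Matrix (Fin 3) (Fin 3) ℝ :=
  !![2 / θ 0 ^ 2, 0, 0;
     0, θ 2 ^ 2 / θ 1 ^ 2 * kappa0 (θ 0) (θ 1) (θ 2),
        θ 2 / θ 1 * kappa0 (θ 0) (θ 1) (θ 2) * kappa1 (θ 0) (θ 1) (θ 2);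
     0, θ 2 / θ 1 * kappa0 (θ 0) (θ 1) (θ 2) * kappa1 (θ 0) (θ 1) (θ 2),
        kappa0 (θ 0) (θ 1) (θ 2) * (kappa1 (θ 0) (θ 1) (θ 2) ^ 2 + 1 / θ 2 ^ 2)]

/-- `ℙ_n`, the `n`-fold product of the law with Lebesgue density `p_{1/n}(·, θ)`. -/
def Pn (n : ℕ) (θ : Fin 3 → ℝ) : Measure (Fin n → ℝ) :=
  Measure.pi fun _ => MeasureTheory.volume.withDensity fun y => ENNReal.ofReal (pdens n θ y)

/-- The standard Gaussian measure on `ℝ³`. -/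
def stdGauss3 : Measure (Fin 3 → ℝ) :=
  Measure.pi fun _ => ProbabilityTheory.gaussianReal 0 1

/-- Euclidean (Frobenius) norm of a real 3×3 matrix. -/
def frobNorm (M : Matrix (Fin 3) (Fin 3) ℝ) : ℝ := Real.sqrt (∑ i, ∑ j, M i j ^ 2)

/-- Euclidean norm of a vector of `ℝ³`. -/
def vecNorm (v : Fin 3 → ℝ) : ℝ := Real.sqrt (∑ j, v j ^ 2)

/-- The admissible families of functions `ψ_α^{(p)}`. -/
structure IsPsiFamily (ψ : ℝ → ℕ → ℝ → ℝ) : Prop where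
  contDiff : ∀ α ∈ Set.Ioo (0 : ℝ) 2, ∀ p : ℕ, ContDiff ℝ 2 (ψ α p)
  pos : ∀ α ∈ Set.Ioo (0 : ℝ) 2, ∀ p : ℕ, ∀ y : ℝ, 0 < ψ α p y
  even : ∀ α ∈ Set.Ioo (0 : ℝ) 2, ∀ p : ℕ, ∀ y : ℝ, ψ α p (-y) = ψ α p y
  eq_one : ∀ α ∈ Set.Ioo (0 : ℝ) 2, ∀ p : ℕ, ∀ y : ℝ, |y| ≤ 1 → ψ α p y = 1
  eq_tail : ∀ α ∈ Set.Ioo (0 : ℝ) 2, ∀ p : ℕ, ∀ y : ℝ, 3 ≤ |y| →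
    ψ α p y = Real.log |y| ^ p / |y| ^ (α + 1)
  unifBound : ∀ K : Set ℝ, K ⊆ Set.Ioo (0 : ℝ) 2 → IsCompact K → ∀ p : ℕ,
    ∃ c > (0 : ℝ), ∃ C : ℝ, ∀ α ∈ K, ∀ y : ℝ, 1 ≤ |y| → |y| ≤ 3 →
      c ≤ ψ α p y ∧ ψ α p y ≤ C

/-- `𝓘_α^{(k,l)}`. -/
def Ical (ψ : ℝ → ℕ → ℝ → ℝ) (α : ℝ) (k l : ℕ) (y : ℝ) : ℝ :=
  ∫ z in {z : ℝ | 1 < |z|}, Dop^[k] gauss (y - z) * ψ α l z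

/-- `f_α^{(k,l,m)}`. -/
def fklm (α : ℝ) (k l m : ℕ) (y w : ℝ) : ℝ :=
  ∫ z : ℝ, Dop^[k] gauss (y - w * z)
    * Dop^[l] (fun z' => iteratedDeriv m (fun a => stableDensity a z') α) z

def Gamman (n : ℕ) (α : ℝ) : ℝ := Real.sqrt ((1 - α / 2) * Real.log n)

def Mn (n : ℕ) (α : ℝ) : ℝ := Real.sqrt ((2 - α) * Real.log n)

def Kconst (σ δ α : ℝ) : ℝ := deriv cAlpha α + cAlpha α * Real.log (δ / σ)

lemma gauss_pos (x : ℝ) : 0 < gauss x := by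
  unfold gauss; positivity

lemma gauss_continuous : Continuous gauss := by
  unfold gauss; fun_prop

lemma gauss_even (x : ℝ) : gauss (-x) = gauss x := by
  unfold gauss; simp

lemma gauss_eq_pdf (x : ℝ) : gauss x = ProbabilityTheory.gaussianPDFReal 0 1 x := by
  simp [gauss, ProbabilityTheory.gaussianPDFReal]

lemma gauss_integrable : Integrable gauss := by
  have : gauss = ProbabilityTheory.gaussianPDFReal 0 1 := funext gauss_eq_pdf
  rw [this]; exact ProbabilityTheory.integrable_gaussianPDFReal 0 1

lemma integrable_pow_exp (n : ℕ) : Integrable (fun x : ℝ => x ^ n * Real.exp (-(x ^ 2) / 2)) := by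
  have := integrable_rpow_mul_exp_neg_mul_sq (b := 1/2) (by norm_num) (s := n) (by
    have : (0:ℝ) ≤ n := by positivity
    linarith)
  refine this.congr (Eventually.of_forall fun x => ?_)
  simp only [Real.rpow_natCast]
  congr 2; ring

lemma gauss_pow_integrable (n : ℕ) : Integrable (fun x : ℝ => x ^ n * gauss x) := by
  refine ((integrable_pow_exp n).const_mul (Real.sqrt (2 * Real.pi))⁻¹).congr
    (Eventually.of_forall fun x => ?_)
  simp only [gauss]; ring

lemma gauss_hasDerivAt (x : ℝ) : HasDerivAt gauss (-x * gauss x) x := by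
  unfold gauss
  have h1 : HasDerivAt (fun y : ℝ => -(y ^ 2) / 2) (-x) x := by
    have := ((hasDerivAt_pow 2 x).neg).div_const 2
    refine this.congr_deriv ?_
    push_cast; ring
  exact (h1.exp.const_mul ((Real.sqrt (2 * Real.pi))⁻¹)).congr_deriv (by ring)

lemma Dop_gauss (x : ℝ) : Dop gauss x = (1 - x ^ 2) * gauss x := by
  rw [Dop, (gauss_hasDerivAt x).deriv]; ring

lemma gauss_fourier (v : ℝ) : ∫ x, gauss x * Real.cos (x * v) = Real.exp (-(v ^ 2) / 2) := by
  have h := ProbabilityTheory.charFun_gaussianReal (μ := 0) (v := 1) v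
  rw [charFun_apply_real, ProbabilityTheory.gaussianReal_of_var_ne_zero _ one_ne_zero] at h
  rw [integral_withDensity_eq_integral_toReal_smul
    (ProbabilityTheory.measurable_gaussianPDF 0 1)
    (ae_of_all _ fun _ => ProbabilityTheory.gaussianPDF_lt_top)] at h
  have h2 := congrArg Complex.re h
  have hint : Integrable (fun x : ℝ => (ProbabilityTheory.gaussianPDF 0 1 x).toReal •
      Complex.exp (v * x * Complex.I)) := by
    refine (ProbabilityTheory.integrable_gaussianPDFReal 0 1).mono ?_ (ae_of_all _ fun x => ?_)
    · apply Measurable.aestronglyMeasurable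
      have := (ProbabilityTheory.measurable_gaussianPDF 0 1).ennreal_toReal
      apply this.smul
      fun_prop
    · rw [norm_smul, ← Complex.ofReal_mul, Complex.norm_exp_ofReal_mul_I, mul_one]
      simp [ProbabilityTheory.toReal_gaussianPDF]
  have h3 := integral_re hint
  simp only [RCLike.re_eq_complex_re] at h3
  rw [← h3] at h2
  have e2 : (Complex.exp (v * (0:ℝ) * Complex.I - ((1 : NNReal) : ℝ) * v ^ 2 / 2)).re = Real.exp (-(v ^ 2) / 2) := by
    have : (v * (0:ℝ) * Complex.I - ((1 : NNReal) : ℝ) * v ^ 2 / 2 : ℂ) = ((-(v ^ 2) / 2 : ℝ) : ℂ) := by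
      push_cast; ring
    rw [this, ← Complex.ofReal_exp, Complex.ofReal_re]
  rw [e2] at h2
  rw [← h2]
  congr 1; ext x
  rw [Complex.smul_re, ← Complex.ofReal_mul, Complex.exp_ofReal_mul_I_re,
    ProbabilityTheory.toReal_gaussianPDF, gauss_eq_pdf, mul_comm v x]
  rfl

lemma cos_gauss_fourier (y : ℝ) :
    ∫ u, Real.cos (y * u) * Real.exp (-(u ^ 2) / 2) = 2 * Real.pi * gauss y := by
  have h := gauss_fourier y
  have hs : Real.sqrt (2 * Real.pi) ≠ 0 := by positivity
  have e : ∀ u, Real.cos (y * u) * Real.exp (-(u ^ 2) / 2)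
      = Real.sqrt (2 * Real.pi) * (gauss u * Real.cos (u * y)) := by
    intro u; unfold gauss; rw [mul_comm y u]; field_simp
  simp_rw [e]
  rw [integral_const_mul, h]
  unfold gauss
  have : 2 * Real.pi = Real.sqrt (2 * Real.pi) * Real.sqrt (2 * Real.pi) := by
    rw [Real.mul_self_sqrt]; positivity
  generalize Real.sqrt (2 * Real.pi) = c at *
  rw [this]
  field_simp

lemma int_mul_cos {F : ℝ → ℝ} (hF : Integrable F) (v : ℝ) :
    Integrable (fun x => F x * Real.cos (x * v)) := by
  refine hF.mul_bdd (c := 1) (by fun_prop) (ae_of_all _ fun x => ?_)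
  simpa using Real.abs_cos_le_one _

lemma int_mul_sin {F : ℝ → ℝ} (hF : Integrable F) (v : ℝ) :
    Integrable (fun x => F x * Real.sin (x * v)) := by
  refine hF.mul_bdd (c := 1) (by fun_prop) (ae_of_all _ fun x => ?_)
  simpa using Real.abs_sin_le_one _

lemma xgauss_fourier (v : ℝ) :
    ∫ x, x * gauss x * Real.sin (x * v) = v * Real.exp (-(v ^ 2) / 2) := by
  have i1 : Integrable (fun x => x * gauss x) := by simpa using gauss_pow_integrable 1
  have h := integral_mul_deriv_eq_deriv_mul_of_integrable
    (u := fun x => Real.sin (x * v)) (v := gauss)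
    (u' := fun x => Real.cos (x * v) * v) (v' := fun x => -x * gauss x)
    (fun x _ => by simpa using ((hasDerivAt_id x).mul_const v).sin) (fun x _ => gauss_hasDerivAt x)
    ((int_mul_sin i1 v).neg.congr (ae_of_all _ fun x => by simp; ring))
    (((int_mul_cos gauss_integrable v).const_mul v).congr (ae_of_all _ fun x => by simp; ring))
    ((int_mul_sin gauss_integrable v).congr (ae_of_all _ fun x => by simp; ring))
  have e1 : ∀ x, x * gauss x * Real.sin (x * v) = -(Real.sin (x * v) * (-x * gauss x)) := by
    intro x; ring
  simp_rw [e1]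
  rw [integral_neg, h, neg_neg, ← gauss_fourier v, ← integral_const_mul]
  congr 1; ext x; ring

lemma Dgauss_fourier (v : ℝ) :
    ∫ x, (1 - x ^ 2) * gauss x * Real.cos (x * v) = v ^ 2 * Real.exp (-(v ^ 2) / 2) := by
  have i1 : Integrable (fun x => x * gauss x) := by simpa using gauss_pow_integrable 1
  have i2 : Integrable (fun x => (1 - x ^ 2) * gauss x) :=
    (gauss_integrable.sub (gauss_pow_integrable 2)).congr (ae_of_all _ fun x => by simp; ring)
  have h := integral_mul_deriv_eq_deriv_mul_of_integrable
    (u := fun x => Real.cos (x * v)) (v := fun x => x * gauss x)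
    (u' := fun x => -Real.sin (x * v) * v) (v' := fun x => (1 - x ^ 2) * gauss x)
    (fun x _ => by simpa using ((hasDerivAt_id x).mul_const v).cos)
    (fun x _ => ((hasDerivAt_id x).mul (gauss_hasDerivAt x)).congr_deriv (by simp; ring))
    ((int_mul_cos i2 v).congr (ae_of_all _ fun x => by simp; ring))
    (((int_mul_sin i1 v).const_mul (-v)).congr (ae_of_all _ fun x => by simp; ring))
    ((int_mul_cos i1 v).congr (ae_of_all _ fun x => by simp; ring))
  have e1 : ∀ x, (1 - x ^ 2) * gauss x * Real.cos (x * v)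
      = Real.cos (x * v) * ((1 - x ^ 2) * gauss x) := by
    intro x; ring
  simp_rw [e1]
  have hx := xgauss_fourier v
  rw [h, ← integral_neg, pow_two v, mul_assoc, ← hx.trans (by ring_nf : _ = v * Real.exp (-(v*v)/2)), ← integral_const_mul]
  congr 1; ext x; ring

lemma cos_sq_gauss_fourier (y : ℝ) :
    ∫ u, Real.cos (y * u) * (u ^ 2 * Real.exp (-(u ^ 2) / 2))
      = 2 * Real.pi * ((1 - y ^ 2) * gauss y) := by
  have h := Dgauss_fourier y
  have h0 := gauss_fourier y
  have hs : Real.sqrt (2 * Real.pi) ≠ 0 := by positivity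
  have i2 : Integrable (fun x => (1 - x ^ 2) * gauss x) :=
    (gauss_integrable.sub (gauss_pow_integrable 2)).congr (ae_of_all _ fun x => by simp; ring)
  have e : ∀ u, Real.cos (y * u) * (u ^ 2 * Real.exp (-(u ^ 2) / 2))
      = Real.sqrt (2 * Real.pi) * (gauss u * Real.cos (u * y) -
        (1 - u ^ 2) * gauss u * Real.cos (u * y)) := by
    intro u; unfold gauss; rw [mul_comm y u]; field_simp; ring
  simp_rw [e]
  rw [integral_const_mul, integral_sub (int_mul_cos gauss_integrable y) (int_mul_cos i2 y), h, h0]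
  unfold gauss
  have : 2 * Real.pi = Real.sqrt (2 * Real.pi) * Real.sqrt (2 * Real.pi) := by
    rw [Real.mul_self_sqrt]; positivity
  generalize Real.sqrt (2 * Real.pi) = c at *
  rw [this]
  field_simp

/-- Fubini for a convolution with a cosine transform. -/
lemma conv_fourier {F r : ℝ → ℝ} (hF : Integrable F)
    (hFe : ∀ x, F (-x) = F x) (hr : Integrable r) {w : ℝ} (hw : 0 < w) (y : ℝ) :
    ∫ z, F (y - w * z) * ((2 * Real.pi)⁻¹ * ∫ u, Real.cos (z * u) * r u)
      = (2 * Real.pi)⁻¹ * ∫ v, Real.cos (y * v) * (∫ x, F x * Real.cos (x * v)) * r (w * v) := by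
  have hFw : Integrable (fun z => F (y - w * z)) := by
    have h1 : Integrable (fun z => F (y - z)) := hF.comp_sub_left y
    exact h1.comp_mul_left' hw.ne'
  have e1 : ∀ z, F (y - w * z) * ((2 * Real.pi)⁻¹ * ∫ u, Real.cos (z * u) * r u)
      = (2 * Real.pi)⁻¹ * ∫ u, F (y - w * z) * (Real.cos (z * u) * r u) := by
    intro z; rw [integral_const_mul]; ring
  simp_rw [e1]
  rw [integral_const_mul]
  congr 1
  rw [integral_integral_swap]
  · have e2 : ∀ u, ∫ z, F (y - w * z) * (Real.cos (z * u) * r u)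
        = w⁻¹ * (Real.cos (y * (u / w)) * (∫ x, F x * Real.cos (x * (u / w))) * r u) := by
      intro u
      have e3 : ∀ z, F (y - w * z) * (Real.cos (z * u) * r u)
          = (fun t => F (y - t) * Real.cos (t * (u / w))) (w * z) * r u := by
        intro z
        have : w * z * (u / w) = z * u := by field_simp
        simp only [this]; ring
      simp_rw [e3]
      rw [integral_mul_const, Measure.integral_comp_mul_left (fun t => F (y - t) * Real.cos (t * (u / w)))]
      rw [← integral_sub_left_eq_self (fun t => F (y - t) * Real.cos (t * (u / w))) volume y]
      have e4 : ∀ x, F (y - (y - x)) * Real.cos ((y - x) * (u / w))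
          = Real.cos (y * (u / w)) * (F x * Real.cos (x * (u / w)))
            + Real.sin (y * (u / w)) * (F x * Real.sin (x * (u / w))) := by
        intro x; rw [sub_mul, Real.cos_sub, sub_sub_cancel]; ring
      simp_rw [e4]
      rw [integral_add ((int_mul_cos hF _).const_mul _) ((int_mul_sin hF _).const_mul _),
        integral_const_mul, integral_const_mul]
      have e5 : ∫ x, F x * Real.sin (x * (u / w)) = 0 := by
        have := integral_neg_eq_self (fun x => F x * Real.sin (x * (u / w))) volume
        simp only [hFe, neg_mul, Real.sin_neg, mul_neg, integral_neg] at this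
        linarith
      rw [e5, abs_of_pos (inv_pos.mpr hw), smul_eq_mul]
      ring
    simp_rw [e2]
    rw [integral_const_mul]
    have := Measure.integral_comp_mul_left (fun u => Real.cos (y * (u / w)) *
      (∫ x, F x * Real.cos (x * (u / w))) * r u) w
    rw [abs_of_pos (inv_pos.mpr hw), smul_eq_mul] at this
    rw [← this]
    congr 1; ext v
    have : w * v / w = v := by field_simp
    simp only [this]
  · have hp : Integrable (fun p : ℝ × ℝ => F (y - w * p.1) * r p.2) (volume.prod volume) :=
      hFw.mul_prod hr
    refine (hp.mul_bdd (c := 1) (g := fun p : ℝ × ℝ => Real.cos (p.1 * p.2)) (by fun_prop)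
      (ae_of_all _ fun x => by simpa using Real.abs_cos_le_one _)).congr (ae_of_all _ fun p => ?_)
    simp only [Function.uncurry]; ring

lemma expabs_int {α s : ℝ} (hα : 0 < α) (hs : -1 < s) :
    Integrable (fun u : ℝ => |u| ^ s * Real.exp (-(|u| ^ α))) := by
  apply Integrable.of_integral_ne_zero
  rw [integral_comp_abs (f := fun x => x ^ s * Real.exp (-(x ^ α)))]
  rw [integral_rpow_mul_exp_neg_rpow hα hs]
  have : 0 < Real.Gamma ((s + 1) / α) := Real.Gamma_pos_of_pos (by apply div_pos <;> linarith)
  positivity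

lemma expabs_int0 {α : ℝ} (hα : 0 < α) : Integrable (fun u : ℝ => Real.exp (-(|u| ^ α))) := by
  simpa using expabs_int hα (s := 0) (by norm_num)

lemma abs_log_le {x ε : ℝ} (hx : 0 < x) (hε : 0 < ε) : |Real.log x| ≤ (x ^ ε + x ^ (-ε)) / ε := by
  have h1 := Real.log_le_rpow_div hx.le hε
  have h2 := Real.log_le_rpow_div (inv_pos.mpr hx).le hε
  rw [Real.log_inv, Real.inv_rpow hx.le, ← Real.rpow_neg hx.le] at h2
  have h3 : 0 < x ^ ε := Real.rpow_pos_of_pos hx _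
  have h4 : 0 < x ^ (-ε) := Real.rpow_pos_of_pos hx _
  rw [abs_le, add_div]
  have h5 : 0 < x ^ ε / ε := by positivity
  have h6 : 0 < x ^ (-ε) / ε := by positivity
  constructor <;> linarith

lemma logexpabs_int {α : ℝ} (hα : 0 < α) :
    Integrable (fun u : ℝ => |u| ^ α * Real.log |u| * Real.exp (-(|u| ^ α))) := by
  have i1 := expabs_int hα (s := 2 * α) (by linarith)
  have i2 := expabs_int0 hα
  refine ((i1.add i2).const_mul (1/α)).mono' ?_ (ae_of_all _ fun u => ?_)
  · apply Measurable.aestronglyMeasurable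
    fun_prop
  · rcases eq_or_ne u 0 with rfl | hu
    · simp only [abs_zero, Real.log_zero, mul_zero, zero_mul, norm_zero, Pi.add_apply]
      positivity
    · have hu : 0 < |u| := abs_pos.mpr hu
      have h := abs_log_le hu hα
      have e : |u| ^ α * ((|u| ^ α + |u| ^ (-α)) / α) = 1 / α * (|u| ^ (2 * α) + 1) := by
        have a1 : |u| ^ α * |u| ^ α = |u| ^ (2 * α) := by rw [← Real.rpow_add hu]; ring_nf
        have a2 : |u| ^ α * |u| ^ (-α) = 1 := by rw [← Real.rpow_add hu]; simp
        linear_combination (1 / α) * a1 + (1 / α) * a2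
      have hp : 0 ≤ |u| ^ α := by positivity
      rw [norm_mul, norm_mul, Real.norm_of_nonneg hp, Real.norm_eq_abs,
        Real.norm_of_nonneg (Real.exp_pos _).le]
      calc |u| ^ α * |(Real.log |u|)| * Real.exp (-|u| ^ α)
          ≤ |u| ^ α * ((|u| ^ α + |u| ^ (-α)) / α) * Real.exp (-|u| ^ α) := by gcongr
        _ = _ := by rw [e]; simp only [Pi.add_apply]; ring

lemma Dgauss_int : Integrable (Dop gauss) := by
  have : Dop gauss = fun x => (1 - x ^ 2) * gauss x := funext Dop_gauss
  rw [this]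
  exact (gauss_integrable.sub (gauss_pow_integrable 2)).congr (ae_of_all _ fun x => by simp; ring)

lemma fFun_eq {α w : ℝ} (hα : 0 < α) (hw : 0 < w) (y : ℝ) :
    fFun α y w = (2 * Real.pi)⁻¹ * ∫ v, Real.cos (y * v) * Real.exp (-(v ^ 2) / 2) *
      Real.exp (-(|w * v| ^ α)) := by
  unfold fFun stableDensity
  rw [conv_fourier gauss_integrable gauss_even (expabs_int0 hα) hw]
  simp_rw [gauss_fourier]

lemma gFun_eq {α w : ℝ} (hα : 0 < α) (hw : 0 < w) (y : ℝ) :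
    gFun α y w = (2 * Real.pi)⁻¹ * ∫ v, Real.cos (y * v) * (v ^ 2 * Real.exp (-(v ^ 2) / 2)) *
      Real.exp (-(|w * v| ^ α)) := by
  unfold gFun stableDensity
  rw [conv_fourier Dgauss_int (fun x => by rw [Dop_gauss, Dop_gauss, gauss_even]; ring)
    (expabs_int0 hα) hw]
  simp_rw [Dop_gauss, Dgauss_fourier]

lemma kFun_eq {α w : ℝ} (hα : 0 < α) (hw : 0 < w) (y : ℝ) :
    kFun α y w = -((2 * Real.pi)⁻¹ * ∫ v, Real.cos (y * v) * Real.exp (-(v ^ 2) / 2) *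
      (|w * v| ^ α * Real.log |w * v| * Real.exp (-(|w * v| ^ α)))) := by
  unfold kFun stableDensityDalpha
  have := conv_fourier gauss_integrable gauss_even (logexpabs_int hα) hw y
  simp_rw [gauss_fourier] at this
  rw [← this, ← integral_neg]
  congr 1; ext z
  have e : ∀ u, Real.cos (z * u) * |u| ^ α * Real.log |u| * Real.exp (-|u| ^ α) =
    Real.cos (z * u) * (|u| ^ α * Real.log |u| * Real.exp (-|u| ^ α)) := by intro u; ring
  simp_rw [e]
  ring

lemma stable_hasDerivAt {α : ℝ} (hα : 0 < α) (z : ℝ) :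
    HasDerivAt (stableDensity α)
      ((2 * Real.pi)⁻¹ * ∫ u, -Real.sin (z * u) * u * Real.exp (-(|u| ^ α))) z := by
  have i1 := expabs_int hα (s := 1) (by norm_num)
  have h := (hasDerivAt_integral_of_dominated_loc_of_deriv_le (μ := volume) (x₀ := z)
    (F := fun z u => Real.cos (z * u) * Real.exp (-(|u| ^ α)))
    (F' := fun z u => -Real.sin (z * u) * u * Real.exp (-(|u| ^ α)))
    (bound := fun u => |u| ^ (1:ℝ) * Real.exp (-(|u| ^ α))) (s := univ) univ_mem
    (Eventually.of_forall fun x => by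
      apply Measurable.aestronglyMeasurable; fun_prop)
    ?_ (by apply Measurable.aestronglyMeasurable; fun_prop) ?_ i1 ?_).2
  · exact h.const_mul _
  · refine ((expabs_int0 hα).bdd_mul (c := 1) (f := fun u => Real.cos (z * u)) (by fun_prop)
      (ae_of_all _ fun x => ?_))
    simpa using Real.abs_cos_le_one _
  · refine ae_of_all _ fun u x _ => ?_
    rw [norm_mul, norm_mul, norm_neg, Real.norm_of_nonneg (Real.exp_pos _).le, Real.rpow_one]
    have := Real.abs_sin_le_one (x * u)
    simp only [Real.norm_eq_abs]
    gcongr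
    nlinarith [abs_nonneg u]
  · refine ae_of_all _ fun u x _ => ?_
    exact (((hasDerivAt_id x).mul_const u).cos.mul_const _).congr_deriv (by simp)

lemma tendsto_rpow_mul_exp {α : ℝ} (hα : 0 < α) (s : ℝ) :
    Tendsto (fun u : ℝ => u ^ s * Real.exp (-(u ^ α))) atTop (𝓝 0) := by
  have h := (tendsto_rpow_mul_exp_neg_mul_atTop_nhds_zero (s / α) 1 one_pos).comp
    (tendsto_rpow_atTop hα)
  refine h.congr' ?_
  filter_upwards [eventually_gt_atTop 0] with u hu
  simp only [Function.comp]
  rw [← Real.rpow_mul hu.le]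
  congr 2
  · field_simp
  · ring

lemma Dstable {α : ℝ} (hα : 0 < α) (z : ℝ) :
    Dop (stableDensity α) z = (2 * Real.pi)⁻¹ *
      ∫ u, Real.cos (z * u) * (α * |u| ^ α * Real.exp (-(|u| ^ α))) := by
  have ic : ∀ s : ℝ, -1 < s → Integrable (fun u : ℝ => |u| ^ s * Real.exp (-(|u| ^ α)) * Real.cos (z * u)) := by
    intro s hs
    refine (expabs_int hα hs).mul_bdd (c := 1) (by fun_prop) (ae_of_all _ fun x => ?_)
    simpa using Real.abs_cos_le_one _
  have is : Integrable (fun u : ℝ => |u| ^ (1:ℝ) * Real.exp (-(|u| ^ α)) * Real.sin (z * |u|)) := by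
    refine (expabs_int hα (by norm_num)).mul_bdd (c := 1) (by fun_prop) (ae_of_all _ fun x => ?_)
    simpa using Real.abs_sin_le_one _
  have cabs : ∀ u, Real.cos (z * |u|) = Real.cos (z * u) := by
    intro u; rcases abs_choice u with h | h <;> rw [h] <;> simp
  have sabs : ∀ u, Real.sin (z * |u|) * |u| = Real.sin (z * u) * u := by
    intro u; rcases abs_choice u with h | h <;> rw [h] <;> simp
  have e1 : ∀ u, |u| ^ (0:ℝ) * Real.exp (-(|u| ^ α)) * Real.cos (z * u)
      = Real.cos (z * |u|) * Real.exp (-(|u| ^ α)) := by intro u; rw [cabs]; simp; ring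
  have i0 : Integrable (fun u => Real.cos (z * |u|) * Real.exp (-(|u| ^ α))) := by
    refine (ic 0 (by norm_num)).congr (ae_of_all _ fun u => e1 u)
  have i1 : Integrable (fun u => Real.sin (z * |u|) * |u| * Real.exp (-(|u| ^ α))) := by
    refine is.congr (ae_of_all _ fun u => ?_); simp; ring
  have i2 : Integrable (fun u => Real.cos (z * |u|) * (α * |u| ^ α * Real.exp (-(|u| ^ α)))) := by
    refine ((ic α (by linarith)).const_mul α).congr (ae_of_all _ fun u => ?_)
    simp only [cabs]; ring
  have key : ∫ u, (Real.cos (z * |u|) * Real.exp (-(|u| ^ α)) - z * (Real.sin (z * |u|) * |u| * Real.exp (-(|u| ^ α)))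
      - Real.cos (z * |u|) * (α * |u| ^ α * Real.exp (-(|u| ^ α)))) = 0 := by
    have iall := (i0.sub (i1.const_mul z)).sub i2
    rw [integral_comp_abs (f := fun u => Real.cos (z * u) * Real.exp (-(u ^ α)) - z * (Real.sin (z * u) * u * Real.exp (-(u ^ α)))
      - Real.cos (z * u) * (α * u ^ α * Real.exp (-(u ^ α))))]
    rw [integral_Ioi_of_hasDerivAt_of_tendsto (m := 0)
      (f := fun u => u * Real.cos (z * u) * Real.exp (-(u ^ α)))]
    · simp
    · have : Continuous (fun u : ℝ => u * Real.cos (z * u) * Real.exp (-(u ^ α))) := by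
        have := Real.continuous_rpow_const (q := α) hα.le
        fun_prop
      exact this.continuousWithinAt
    · intro u hu
      have hu : 0 < u := hu
      have hd : HasDerivAt (fun u : ℝ => u ^ α) (α * u ^ (α - 1)) u :=
        Real.hasDerivAt_rpow_const (Or.inl hu.ne')
      have hc : HasDerivAt (fun u : ℝ => Real.cos (z * u)) (-Real.sin (z * u) * z) u := by
        simpa using ((hasDerivAt_id u).const_mul z).cos
      have := ((hasDerivAt_id u).mul hc).mul (hd.neg.exp)
      refine this.congr_deriv ?_
      have e : u ^ α = u * u ^ (α - 1) := by
        rw [Real.rpow_sub_one hu.ne']; field_simp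
      simp only [id, Pi.mul_apply, Pi.neg_apply]
      conv_rhs => rw [mul_comm α (u ^ α)]
      rw [show u ^ α * α = u * u ^ (α - 1) * α by rw [← e]]
      ring
    · refine (iall.integrableOn (s := Ioi 0)).congr_fun (fun u hu => ?_) measurableSet_Ioi
      have hu : 0 < u := hu
      simp only [Pi.sub_apply, abs_of_pos hu]
    · have h := tendsto_rpow_mul_exp hα 1
      refine squeeze_zero_norm' ?_ h
      filter_upwards [eventually_gt_atTop 0] with u hu
      rw [norm_mul, norm_mul, Real.norm_of_nonneg hu.le, Real.norm_of_nonneg (Real.exp_pos _).le, Real.rpow_one]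
      have := Real.abs_cos_le_one (z * u)
      simp only [Real.norm_eq_abs]
      gcongr
      nlinarith
  have i3 : Integrable (fun u => Real.cos (z * |u|) * Real.exp (-(|u| ^ α)) - z * (Real.sin (z * |u|) * |u| * Real.exp (-(|u| ^ α)))) :=
    i0.sub (i1.const_mul z)
  rw [integral_sub i3 i2, integral_sub i0 (i1.const_mul z), integral_const_mul] at key
  rw [Dop, (stable_hasDerivAt hα z).deriv, stableDensity]
  simp_rw [cabs, sabs] at key
  have e5 : ∫ u, -Real.sin (z * u) * u * Real.exp (-(|u| ^ α)) = -∫ u, Real.sin (z * u) * u * Real.exp (-(|u| ^ α)) := by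
    rw [← integral_neg]; congr 1; ext u; ring
  rw [e5]
  linear_combination (2 * Real.pi)⁻¹ * key

lemma hFun_eq {α w : ℝ} (hα : 0 < α) (hw : 0 < w) (y : ℝ) :
    hFun α y w = (2 * Real.pi)⁻¹ * ∫ v, Real.cos (y * v) * Real.exp (-(v ^ 2) / 2) *
      (α * |w * v| ^ α * Real.exp (-(|w * v| ^ α))) := by
  unfold hFun
  simp_rw [Dstable hα]
  have i : Integrable (fun u : ℝ => α * |u| ^ α * Real.exp (-(|u| ^ α))) :=
    ((expabs_int hα (s := α) (by linarith)).const_mul α).congr (ae_of_all _ fun u => by simp; ring)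
  rw [conv_fourier gauss_integrable gauss_even i hw]
  simp_rw [gauss_fourier]

/-- `M` has three scale-invariant derivatives `u d/du` on `(0,∞)`, all bounded by `β`. -/
def TB (M β : ℝ → ℝ) : Prop :=
  ∃ F1 F2 F3 : ℝ → ℝ, ∀ u : ℝ, 0 < u →
    (HasDerivAt M (F1 u / u) u ∧ HasDerivAt F1 (F2 u / u) u ∧ HasDerivAt F2 (F3 u / u) u) ∧
    (|M u| ≤ β u ∧ |F1 u| ≤ β u ∧ |F2 u| ≤ β u ∧ |F3 u| ≤ β u)

lemma TB.mono {M β γ : ℝ → ℝ} (h : TB M β) (hle : ∀ u, 0 < u → β u ≤ γ u) : TB M γ := by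
  obtain ⟨F1, F2, F3, h⟩ := h
  refine ⟨F1, F2, F3, fun u hu => ?_⟩
  obtain ⟨h1, h2, h3, h4, h5⟩ := h u hu
  have := hle u hu
  exact ⟨h1, h2.trans this, h3.trans this, h4.trans this, h5.trans this⟩

lemma TB.scale {M β : ℝ → ℝ} (h : TB M β) {c : ℝ} (hc : 0 < c) :
    TB (fun u => M (c * u)) (fun u => β (c * u)) := by
  obtain ⟨F1, F2, F3, h⟩ := h
  refine ⟨fun u => F1 (c * u), fun u => F2 (c * u), fun u => F3 (c * u), fun u hu => ?_⟩
  obtain ⟨⟨h1, h2, h3⟩, h4⟩ := h (c * u) (by positivity)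
  have hl : HasDerivAt (fun u => c * u) c u := by simpa using (hasDerivAt_id u).const_mul c
  refine ⟨⟨?_, ?_, ?_⟩, h4⟩
  · exact (h1.comp u hl).congr_deriv (by field_simp)
  · exact (h2.comp u hl).congr_deriv (by field_simp)
  · exact (h3.comp u hl).congr_deriv (by field_simp)

lemma abs_mul_le' {a b x y : ℝ} (h1 : |a| ≤ x) (h2 : |b| ≤ y) : |a * b| ≤ x * y := by
  rw [abs_mul]; exact mul_le_mul h1 h2 (abs_nonneg _) ((abs_nonneg _).trans h1)

lemma TB.mul {M N β γ : ℝ → ℝ} (h : TB M β) (h' : TB N γ) :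
    TB (fun u => M u * N u) (fun u => 8 * (β u * γ u)) := by
  obtain ⟨F1, F2, F3, h⟩ := h
  obtain ⟨G1, G2, G3, h'⟩ := h'
  refine ⟨fun u => F1 u * N u + M u * G1 u, fun u => F2 u * N u + 2 * (F1 u * G1 u) + M u * G2 u,
    fun u => F3 u * N u + 3 * (F2 u * G1 u) + 3 * (F1 u * G2 u) + M u * G3 u, fun u hu => ?_⟩
  obtain ⟨⟨d1, d2, d3⟩, a0, a1, a2, a3⟩ := h u hu
  obtain ⟨⟨e1, e2, e3⟩, b0, b1, b2, b3⟩ := h' u hu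
  refine ⟨⟨?_, ?_, ?_⟩, ?_, ?_, ?_, ?_⟩
  · exact (d1.mul e1).congr_deriv (by field_simp)
  · exact ((d2.mul e1).add (d1.mul e2)).congr_deriv (by field_simp; ring)
  · exact (((d3.mul e1).add ((d2.mul e2).const_mul 2)).add (d1.mul e3)).congr_deriv
      (by field_simp; ring)
  · have := abs_le.mp (abs_mul_le' a0 b0)
    have h0 : 0 ≤ β u * γ u := (abs_nonneg _).trans (abs_mul_le' a0 b0)
    rw [abs_le]; constructor <;> linarith
  · have t1 := abs_le.mp (abs_mul_le' a1 b0)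
    have t2 := abs_le.mp (abs_mul_le' a0 b1)
    rw [abs_le]; constructor <;> linarith
  · have t1 := abs_le.mp (abs_mul_le' a2 b0)
    have t2 := abs_le.mp (abs_mul_le' a1 b1)
    have t3 := abs_le.mp (abs_mul_le' a0 b2)
    rw [abs_le]; constructor <;> linarith
  · have t1 := abs_le.mp (abs_mul_le' a3 b0)
    have t2 := abs_le.mp (abs_mul_le' a2 b1)
    have t3 := abs_le.mp (abs_mul_le' a1 b2)
    have t4 := abs_le.mp (abs_mul_le' a0 b3)
    rw [abs_le]; constructor <;> linarith

lemma TB.log : TB Real.log (fun u => 1 + |Real.log u|) := by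
  refine ⟨fun _ => 1, fun _ => 0, fun _ => 0, fun u hu => ?_⟩
  have := abs_nonneg (Real.log u)
  refine ⟨⟨?_, ?_, ?_⟩, by linarith, by simp, ?_, ?_⟩
  · simpa using Real.hasDerivAt_log hu.ne'
  · simpa using hasDerivAt_const u (1:ℝ)
  · simpa using hasDerivAt_const u (0:ℝ)
  · simp; linarith
  · simp; linarith

lemma TB.pow {p : ℝ → ℝ} {α : ℝ} (h0 : 0 ≤ α) (h2 : α ≤ 2)
    (hp : ∀ u, 0 < u → HasDerivAt p (α * p u / u) u) (hp0 : ∀ u, 0 < u → 0 ≤ p u) :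
    TB p (fun u => 8 * p u) := by
  refine ⟨fun u => α * p u, fun u => α ^ 2 * p u, fun u => α ^ 3 * p u, fun u hu => ?_⟩
  have hu0 := hp0 u hu
  have hd := hp u hu
  have k2 : α ^ 2 ≤ 8 := by nlinarith
  have k3 : α ^ 3 ≤ 8 := by
    calc α ^ 3 ≤ 2 ^ 3 := by gcongr
      _ = 8 := by norm_num
  refine ⟨⟨hd, ?_, ?_⟩, ?_, ?_, ?_, ?_⟩
  · exact (hd.const_mul α).congr_deriv (by ring)
  · exact (hd.const_mul (α ^ 2)).congr_deriv (by ring)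
  · rw [abs_of_nonneg hu0]; linarith
  · rw [abs_of_nonneg (by positivity)]; exact mul_le_mul_of_nonneg_right (by linarith) hu0
  · rw [abs_of_nonneg (by positivity)]; exact mul_le_mul_of_nonneg_right (by linarith) hu0
  · rw [abs_of_nonneg (by positivity)]; exact mul_le_mul_of_nonneg_right (by linarith) hu0

lemma exp_pow_bounds {x : ℝ} (hx : 0 ≤ x) :
    x ≤ Real.exp x ∧ x ^ 2 ≤ 2 * Real.exp x ∧ x ^ 3 ≤ 6 * Real.exp x := by
  refine ⟨?_, ?_, ?_⟩
  · have := Real.add_one_le_exp x; linarith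
  · have := Real.pow_div_factorial_le_exp x hx 2
    simp [Nat.factorial] at this; linarith
  · have := Real.pow_div_factorial_le_exp x hx 3
    simp [Nat.factorial] at this; linarith

lemma exp_chain {p : ℝ → ℝ} {α : ℝ} 
    (hp : ∀ u, 0 < u → HasDerivAt p (α * p u / u) u) (c : ℝ) (u : ℝ) (hu : 0 < u) :
    HasDerivAt (fun u => Real.exp (-p u) - c) (-(α * p u * Real.exp (-p u)) / u) u ∧
    HasDerivAt (fun u => -(α * p u * Real.exp (-p u)))
      (α ^ 2 * (p u ^ 2 - p u) * Real.exp (-p u) / u) u ∧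
    HasDerivAt (fun u => α ^ 2 * (p u ^ 2 - p u) * Real.exp (-p u))
      (α ^ 3 * (3 * p u ^ 2 - p u - p u ^ 3) * Real.exp (-p u) / u) u := by
  have hd := hp u hu
  have he := hd.neg.exp
  refine ⟨?_, ?_, ?_⟩
  · exact (he.sub_const c).congr_deriv (by simp; ring)
  · exact ((hd.const_mul α).mul he).neg.congr_deriv (by simp; ring)
  · exact ((((hd.pow 2).sub hd).const_mul (α ^ 2)).mul he).congr_deriv (by simp; ring)

lemma TB.exp_neg {p : ℝ → ℝ} {α : ℝ} (h0 : 0 ≤ α) (h2 : α ≤ 2)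
    (hp : ∀ u, 0 < u → HasDerivAt p (α * p u / u) u) (hp0 : ∀ u, 0 < u → 0 ≤ p u) :
    TB (fun u => Real.exp (-p u)) (fun u => 1000 * Real.exp (-p u / 2)) := by
  refine ⟨_, _, _, fun u hu => ⟨⟨?_, (exp_chain hp 0 u hu).2⟩, ?_⟩⟩
  · simpa using (exp_chain hp 0 u hu).1
  have hu0 := hp0 u hu
  beta_reduce
  generalize p u = x at *
  have k2 : α ^ 2 ≤ 4 := by nlinarith
  have k3 : α ^ 3 ≤ 8 := by
    calc α ^ 3 ≤ 2 ^ 3 := by gcongr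
      _ = 8 := by norm_num
  obtain ⟨b1, b2, b3⟩ := exp_pow_bounds (x := x / 2) (by positivity)
  have e : Real.exp (-x) = Real.exp (-x / 2) * Real.exp (-x / 2) := by
    rw [← Real.exp_add]; ring_nf
  have e1 : Real.exp (x / 2) * Real.exp (-x / 2) = 1 := by
    rw [← Real.exp_add]; ring_nf; simp
  have t0 := Real.exp_pos (-x / 2)
  set t := Real.exp (-x / 2) with ht
  have t1 : t ≤ 1 := by rw [ht]; apply Real.exp_le_one_iff.mpr; linarith
  have c1 : x * t ≤ 2 := by nlinarith
  have c2 : x ^ 2 * t ≤ 8 := by nlinarith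
  have c3 : x ^ 3 * t ≤ 48 := by nlinarith
  have z1 : 0 ≤ x * t := by positivity
  have z2 : 0 ≤ x ^ 2 * t := by positivity
  have z3 : 0 ≤ x ^ 3 * t := by positivity
  rw [e]
  refine ⟨?_, ?_, ?_, ?_⟩
  · rw [abs_of_nonneg (by positivity)]; nlinarith
  · rw [abs_neg, abs_of_nonneg (by positivity)]
    calc α * x * (t * t) = (α * (x * t)) * t := by ring
      _ ≤ (2 * 2) * t := by gcongr
      _ ≤ _ := by linarith
  · have : |(x ^ 2 * t - x * t)| ≤ 10 := by rw [abs_le]; constructor <;> linarith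
    calc |α ^ 2 * (x ^ 2 - x) * (t * t)| = |(α ^ 2 * (x ^ 2 * t - x * t) * t)| := by ring_nf
      _ = α ^ 2 * |(x ^ 2 * t - x * t)| * t := by
        rw [abs_mul, abs_mul, abs_of_pos t0, abs_of_nonneg (sq_nonneg α)]
      _ ≤ 4 * 10 * t := by gcongr
      _ ≤ _ := by linarith
  · have : |(3 * (x ^ 2 * t) - x * t - x ^ 3 * t)| ≤ 100 := by rw [abs_le]; constructor <;> linarith
    calc |α ^ 3 * (3 * x ^ 2 - x - x ^ 3) * (t * t)|
        = |(α ^ 3 * (3 * (x ^ 2 * t) - x * t - x ^ 3 * t) * t)| := by ring_nf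
      _ = α ^ 3 * |(3 * (x ^ 2 * t) - x * t - x ^ 3 * t)| * t := by
        rw [abs_mul, abs_mul, abs_of_pos t0, abs_of_nonneg (pow_nonneg h0 3)]
      _ ≤ 8 * 100 * t := by gcongr
      _ ≤ _ := by linarith

lemma TB.exp_neg_sub {p : ℝ → ℝ} {α : ℝ} (h0 : 0 ≤ α) (h2 : α ≤ 2)
    (hp : ∀ u, 0 < u → HasDerivAt p (α * p u / u) u) (hp0 : ∀ u, 0 < u → 0 ≤ p u) :
    TB (fun u => Real.exp (-p u) - 1) (fun u => 1000 * p u) := by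
  refine ⟨_, _, _, fun u hu => ⟨exp_chain hp 1 u hu, ?_⟩⟩
  have hu0 := hp0 u hu
  beta_reduce
  generalize p u = x at *
  have k2 : α ^ 2 ≤ 4 := by nlinarith
  have k3 : α ^ 3 ≤ 8 := by
    calc α ^ 3 ≤ 2 ^ 3 := by gcongr
      _ = 8 := by norm_num
  obtain ⟨b1, b2, b3⟩ := exp_pow_bounds (x := x) (by positivity)
  have e1 : Real.exp x * Real.exp (-x) = 1 := by
    rw [← Real.exp_add]; ring_nf; simp
  have l1 := Real.add_one_le_exp (-x)
  have t0 := Real.exp_pos (-x)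
  have t1 : Real.exp (-x) ≤ 1 := by apply Real.exp_le_one_iff.mpr; linarith
  set t := Real.exp (-x) with ht
  have c1 : x * t ≤ 1 := by nlinarith
  have c2 : x ^ 2 * t ≤ 2 := by nlinarith
  have z1 : 0 ≤ x * t := by positivity
  have z2 : 0 ≤ x ^ 2 * t := by positivity
  refine ⟨?_, ?_, ?_, ?_⟩
  · rw [abs_le]; constructor <;> linarith
  · rw [abs_neg, abs_of_nonneg (by positivity)]
    calc α * x * t ≤ 2 * x * 1 := by gcongr
      _ ≤ _ := by linarith
  · have : |(x * t - t)| ≤ 2 := by rw [abs_le]; constructor <;> linarith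
    calc |α ^ 2 * (x ^ 2 - x) * t| = |(α ^ 2 * (x * t - t) * x)| := by ring_nf
      _ = α ^ 2 * |(x * t - t)| * x := by
        rw [abs_mul, abs_mul, abs_of_nonneg hu0, abs_of_nonneg (sq_nonneg α)]
      _ ≤ 4 * 2 * x := by gcongr
      _ ≤ _ := by linarith
  · have : |(3 * (x * t) - t - x ^ 2 * t)| ≤ 6 := by rw [abs_le]; constructor <;> linarith
    calc |α ^ 3 * (3 * x ^ 2 - x - x ^ 3) * t|
        = |(α ^ 3 * (3 * (x * t) - t - x ^ 2 * t) * x)| := by ring_nf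
      _ = α ^ 3 * |(3 * (x * t) - t - x ^ 2 * t)| * x := by
        rw [abs_mul, abs_mul, abs_of_nonneg hu0, abs_of_nonneg (pow_nonneg h0 3)]
      _ ≤ 8 * 6 * x := by gcongr
      _ ≤ _ := by linarith

/-- The constant of the oscillatory integral lemma. -/
def oscC (a δ : ℝ) : ℝ := (1 + 1 / a) + (4 + 6 * (1 + 1 / δ) / δ)

lemma rpow_log_small {α a A B v : ℝ} (ha : 0 < a) (haα : a ≤ α)
    (hA : 0 ≤ A) (hB : 0 ≤ B) (hv : 0 < v) (hv1 : v ≤ 1) :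
    v ^ α * (A + B * |Real.log v|) ≤ (1 + 1 / a) * (A + B) := by
  have h1 : v ^ α ≤ 1 := Real.rpow_le_one hv.le hv1 (by linarith)
  have h2 := (Real.abs_log_mul_self_rpow_lt v α hv hv1 (by linarith)).le
  have h3 : 1 / α ≤ 1 / a := one_div_le_one_div_of_le ha haα
  have h4 : 0 ≤ v ^ α := by positivity
  rw [abs_mul, abs_of_nonneg h4] at h2
  have h5 : 0 < 1 / a := by positivity
  calc v ^ α * (A + B * |Real.log v|) = v ^ α * A + B * (|Real.log v| * v ^ α) := by ring
    _ ≤ 1 * A + B * (1 / a) := by gcongr; linarith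
    _ ≤ _ := by nlinarith

lemma osc1 {N β : ℝ → ℝ} {a δ α A B D : ℝ} (h : TB N β) (ha : 0 < a) (hδ : 0 < δ) 
    (haα : a ≤ α) (hαδ : α ≤ 2 - 2 * δ) (hA : 0 ≤ A) (hB : 0 ≤ B)
    (hβ : ∀ v, 0 < v → β v ≤ v ^ α * (A + B * |Real.log v|))
    (hdec : ∀ v, 0 < v → β v ≤ D / v ^ 2) :
    IntegrableOn (fun v => Real.cos v * N v) (Ioi 0) ∧
    |∫ v in Ioi (0:ℝ), Real.cos v * N v| ≤ oscC a δ * (A + B) := by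
  obtain ⟨F1, F2, F3, h⟩ := h
  have hNc : ContinuousOn N (Ioi 0) := fun v hv => (h v hv).1.1.continuousAt.continuousWithinAt
  have hgc : ContinuousOn (fun v => Real.cos v * N v) (Ioi 0) := by fun_prop
  -- near zero
  have iI : IntegrableOn (fun v => Real.cos v * N v) (Ioc 0 1) := by
    have ic : IntegrableOn (fun _ : ℝ => (1 + 1 / a) * (A + B)) (Ioc (0:ℝ) 1) := integrableOn_const (by simp)
    refine ic.mono' 
      ((hgc.mono Ioc_subset_Ioi_self).aestronglyMeasurable measurableSet_Ioc) ?_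
    refine (ae_restrict_mem measurableSet_Ioc).mono fun v hv => ?_
    have h1 := (h v hv.1).2.1.trans ((hβ v hv.1).trans (rpow_log_small ha haα hA hB hv.1 hv.2))
    calc ‖Real.cos v * N v‖ ≤ 1 * ‖N v‖ := by
          rw [norm_mul]; gcongr; simpa using Real.abs_cos_le_one v
      _ ≤ _ := by simpa using h1
  have bI : |∫ v in Ioc (0:ℝ) 1, Real.cos v * N v| ≤ (1 + 1 / a) * (A + B) := by
    have := norm_setIntegral_le_of_norm_le_const (μ := volume) (s := Ioc (0:ℝ) 1) (f := fun v => Real.cos v * N v) (C := (1 + 1 / a) * (A + B)) (by simp) (by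
      intro v hv
      have h1 := (h v hv.1).2.1.trans ((hβ v hv.1).trans (rpow_log_small ha haα hA hB hv.1 hv.2))
      calc ‖Real.cos v * N v‖ ≤ 1 * ‖N v‖ := by
            rw [norm_mul]; gcongr; simpa using Real.abs_cos_le_one v
        _ ≤ _ := by simpa using h1)
    simpa using this
  -- far part
  have ipow2 : IntegrableOn (fun v : ℝ => D / v ^ 2) (Ioi 1) := by
    have this : IntegrableOn (fun v : ℝ => D * v ^ (-2:ℝ)) (Ioi 1) :=
      (integrableOn_Ioi_rpow_of_lt (a := -2) (by norm_num) (c := 1) one_pos).const_mul D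
    refine this.congr_fun (fun v hv => ?_) measurableSet_Ioi
    have hv : 0 < v := lt_trans one_pos hv
    simp only
    rw [Real.rpow_neg hv.le, div_eq_mul_inv]; norm_num
  have iJ : IntegrableOn (fun v => Real.cos v * N v) (Ioi 1) := by
    refine ipow2.mono' ((hgc.mono (Ioi_subset_Ioi zero_le_one)).aestronglyMeasurable measurableSet_Ioi) ?_
    refine (ae_restrict_mem measurableSet_Ioi).mono fun v hv => ?_
    have hv0 : 0 < v := lt_trans one_pos hv
    have h1 := (h v hv0).2.1.trans (hdec v hv0)
    calc ‖Real.cos v * N v‖ ≤ 1 * ‖N v‖ := by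
          rw [norm_mul]; gcongr; simpa using Real.abs_cos_le_one v
      _ ≤ _ := by simpa using h1
  let N3 : ℝ → ℝ := fun v => (F3 v - 3 * F2 v + 2 * F1 v) / v ^ 3
  have bN3 : ∀ v, 1 ≤ v → |N3 v| ≤ 6 * (1 + 1 / δ) * (A + B) * v ^ (-1 - δ) := by
    intro v hv
    have hv0 : 0 < v := lt_of_lt_of_le one_pos hv
    obtain ⟨-, -, b1, b2, b3⟩ := h v hv0
    have b := hβ v hv0
    have l0 : 0 ≤ Real.log v := Real.log_nonneg hv
    have l1 := Real.log_le_rpow_div hv0.le hδ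
    have l2 : 1 ≤ v ^ δ := Real.one_le_rpow hv hδ.le
    have l3 : A + B * |Real.log v| ≤ (1 + 1 / δ) * (A + B) * v ^ δ := by
      rw [abs_of_nonneg l0]
      have : B * Real.log v ≤ B * (v ^ δ / δ) := by gcongr
      have e : B * (v ^ δ / δ) = (1 / δ) * B * v ^ δ := by ring
      have q1 : A ≤ A * v ^ δ := by nlinarith
      have q2 : 0 ≤ (1 / δ) * A * v ^ δ := by positivity
      have q3 : 0 ≤ B * v ^ δ := by positivity
      nlinarith
    have l4 : v ^ α * v ^ δ ≤ v ^ 3 * v ^ (-1 - δ) := by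
      rw [← Real.rpow_add hv0, ← Real.rpow_natCast, ← Real.rpow_add hv0]
      apply Real.rpow_le_rpow_of_exponent_le hv
      push_cast; linarith
    have b' : β v ≤ (1 + 1 / δ) * (A + B) * (v ^ 3 * v ^ (-1 - δ)) := by
      calc β v ≤ v ^ α * (A + B * |Real.log v|) := b
        _ ≤ v ^ α * ((1 + 1 / δ) * (A + B) * v ^ δ) := by gcongr
        _ = (1 + 1 / δ) * (A + B) * (v ^ α * v ^ δ) := by ring
        _ ≤ _ := by gcongr
    have t : |F3 v - 3 * F2 v + 2 * F1 v| ≤ 6 * β v := by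
      rw [abs_le] at *; constructor <;> linarith
    simp only [N3]
    rw [abs_div, abs_of_pos (a := v ^ 3) (by positivity), div_le_iff₀ (by positivity)]
    calc _ ≤ 6 * β v := t
      _ ≤ 6 * ((1 + 1 / δ) * (A + B) * (v ^ 3 * v ^ (-1 - δ))) := by gcongr
      _ = _ := by ring
  have ipw : IntegrableOn (fun v : ℝ => 6 * (1 + 1 / δ) * (A + B) * v ^ (-1 - δ)) (Ioi 1) :=
    (integrableOn_Ioi_rpow_of_lt (by linarith) one_pos).const_mul _
  have mF3 : AEStronglyMeasurable F3 (volume.restrict (Ioi (1:ℝ))) := by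
    have m : Measurable (fun v => v * deriv F2 v) := measurable_id.mul (measurable_deriv F2)
    refine m.aestronglyMeasurable.congr ?_
    refine (ae_restrict_mem measurableSet_Ioi).mono fun v hv => ?_
    have hv0 : 0 < v := lt_trans one_pos hv
    simp only
    rw [(h v hv0).1.2.2.deriv]; field_simp
  have c1 : ContinuousOn F1 (Ioi 1) := fun v hv => (h v (lt_trans one_pos hv)).1.2.1.continuousAt.continuousWithinAt
  have c2 : ContinuousOn F2 (Ioi 1) := fun v hv => (h v (lt_trans one_pos hv)).1.2.2.continuousAt.continuousWithinAt
  have mF1 := c1.aestronglyMeasurable (μ := volume) measurableSet_Ioi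
  have mF2 := c2.aestronglyMeasurable (μ := volume) measurableSet_Ioi
  have mN3 : AEStronglyMeasurable N3 (volume.restrict (Ioi (1:ℝ))) := by
    have : Measurable (fun v : ℝ => (v ^ 3)⁻¹) := by fun_prop
    have q := ((mF3.sub (mF2.const_mul 3)).add (mF1.const_mul 2)).mul this.aestronglyMeasurable
    refine q.congr (ae_of_all _ fun v => ?_)
    simp [N3, div_eq_mul_inv]
  have mS : AEStronglyMeasurable (fun v => N3 v * Real.sin v) (volume.restrict (Ioi (1:ℝ))) :=
    mN3.mul (by fun_prop)
  have bS : ∀ v, 1 ≤ v → ‖N3 v * Real.sin v‖ ≤ 6 * (1 + 1 / δ) * (A + B) * v ^ (-1 - δ) := by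
    intro v hv
    rw [norm_mul]
    calc ‖N3 v‖ * ‖Real.sin v‖ ≤ ‖N3 v‖ * 1 := by
          gcongr; simpa using Real.abs_sin_le_one v
      _ ≤ _ := by simpa using bN3 v hv
  have iS : IntegrableOn (fun v => N3 v * Real.sin v) (Ioi 1) := by
    refine ipw.mono' mS ?_
    exact (ae_restrict_mem measurableSet_Ioi).mono fun v hv => bS v (le_of_lt hv)
  have bSI : |∫ v in Ioi (1:ℝ), N3 v * Real.sin v| ≤ 6 * (1 + 1 / δ) / δ * (A + B) := by
    have e := integral_Ioi_rpow_of_lt (a := -1 - δ) (by linarith) (c := 1) one_pos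
    calc |∫ v in Ioi (1:ℝ), N3 v * Real.sin v|
        ≤ ∫ v in Ioi (1:ℝ), 6 * (1 + 1 / δ) * (A + B) * v ^ (-1 - δ) := by
          have := norm_integral_le_of_norm_le ipw
            ((ae_restrict_mem measurableSet_Ioi).mono fun v hv => bS v (le_of_lt hv))
          simpa using this
      _ = _ := by
        rw [integral_const_mul, e]
        simp only [Real.one_rpow]
        have : -1 - δ + 1 = -δ := by ring
        rw [this]; field_simp
  -- the boundary function
  let Φ : ℝ → ℝ := fun v => N v * Real.sin v + F1 v / v * Real.cos v
    - (F2 v - F1 v) / v ^ 2 * Real.sin v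
  have hΦ : ∀ v ∈ Ici (1:ℝ), HasDerivAt Φ (Real.cos v * N v - N3 v * Real.sin v) v := by
    intro v hv
    have hv0 : 0 < v := lt_of_lt_of_le one_pos hv
    obtain ⟨⟨d0, d1, d2⟩, -⟩ := h v hv0
    have e1 := d1.div (hasDerivAt_id v) hv0.ne'
    have e2 := (d2.sub d1).div (hasDerivAt_pow 2 v) (by positivity)
    have := ((d0.mul (Real.hasDerivAt_sin v)).add (e1.mul (Real.hasDerivAt_cos v))).sub
      (e2.mul (Real.hasDerivAt_sin v))
    refine this.congr_deriv ?_
    simp [N3]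
    field_simp
    ring
  have tΦ : Tendsto Φ atTop (𝓝 0) := by
    have t : Tendsto (fun v : ℝ => 4 * (D / v ^ 2)) atTop (𝓝 0) := by
      have : Tendsto (fun v : ℝ => D / v ^ 2) atTop (𝓝 0) :=
        tendsto_const_nhds.div_atTop (tendsto_pow_atTop two_ne_zero)
      simpa using this.const_mul 4
    refine squeeze_zero_norm' ?_ t
    filter_upwards [eventually_ge_atTop 1] with v hv
    have hv0 : 0 < v := lt_of_lt_of_le one_pos hv
    obtain ⟨-, b0, b1, b2, b3⟩ := h v hv0
    have b := hdec v hv0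
    have q1 : |F1 v / v| ≤ β v := by
      rw [abs_div, abs_of_pos hv0]
      exact (div_le_self (abs_nonneg _) hv).trans b1
    have q2 : |(F2 v - F1 v) / v ^ 2| ≤ 2 * β v := by
      rw [abs_div, abs_of_pos (a := v ^ 2) (by positivity)]
      refine (div_le_self (abs_nonneg _) (one_le_pow₀ hv)).trans ?_
      rw [abs_le] at *; constructor <;> linarith
    have r0 := abs_mul_le' b0 (Real.abs_sin_le_one v)
    have r1 := abs_mul_le' q1 (Real.abs_cos_le_one v)
    have r2 := abs_mul_le' q2 (Real.abs_sin_le_one v)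
    simp only [Φ, Real.norm_eq_abs]
    rw [abs_le] at *; constructor <;> linarith
  have bΦ : |Φ 1| ≤ 4 * (A + B) := by
    obtain ⟨-, b0, b1, b2, b3⟩ := h 1 one_pos
    have b := hβ 1 one_pos
    simp only [Real.one_rpow, Real.log_one, abs_zero, mul_zero, add_zero, one_mul] at b
    have q2 : |(F2 1 - F1 1)| ≤ 2 * β 1 := by
      rw [abs_le] at *; constructor <;> linarith
    have r0 := abs_mul_le' b0 (Real.abs_sin_le_one 1)
    have r1 := abs_mul_le' b1 (Real.abs_cos_le_one 1)
    have r2 := abs_mul_le' q2 (Real.abs_sin_le_one 1)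
    simp only [Φ, div_one, one_pow]
    rw [abs_le] at *; constructor <;> linarith
  have eΦ := integral_Ioi_of_hasDerivAt_of_tendsto' hΦ (iJ.sub iS) tΦ
  rw [integral_sub iJ iS] at eΦ
  have hU : Ioc (0:ℝ) 1 ∪ Ioi 1 = Ioi 0 := Ioc_union_Ioi_eq_Ioi zero_le_one
  refine ⟨hU ▸ iI.union iJ, ?_⟩
  rw [← hU, setIntegral_union (Ioc_disjoint_Ioi le_rfl) measurableSet_Ioi iI iJ]
  have : oscC a δ * (A + B) = (1 + 1 / a) * (A + B) + (4 * (A + B) + 6 * (1 + 1 / δ) / δ * (A + B)) := by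
    unfold oscC; ring
  rw [this]
  rw [abs_le] at *
  constructor <;> linarith

lemma rpow_log_bound {α a A B u : ℝ} (ha : 0 < a) (haα : a ≤ α) (hα2 : α ≤ 2)
    (hA : 0 ≤ A) (hB : 0 ≤ B) (hu : 0 < u) :
    u ^ α * (A + B * |Real.log u|) ≤ (1 + 1 / a) * (A + B) * (1 + u ^ 3) := by
  have ha' : 0 < 1 / a := by positivity
  have hK : 0 ≤ (1 + 1 / a) * (A + B) := by positivity
  rcases le_total u 1 with h1 | h1
  · have := rpow_log_small ha haα hA hB hu h1
    have h3 : 0 ≤ u ^ 3 := by positivity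
    nlinarith
  · have l0 : 0 ≤ Real.log u := Real.log_nonneg h1
    have l1 : Real.log u ≤ u := (Real.log_le_sub_one_of_pos hu).trans (by linarith)
    have l2 : u ^ α ≤ u ^ 2 := by
      rw [← Real.rpow_natCast u 2]; apply Real.rpow_le_rpow_of_exponent_le h1; simpa using hα2
    rw [abs_of_nonneg l0]
    calc u ^ α * (A + B * Real.log u) ≤ u ^ 2 * (A * u + B * u) := by
          gcongr
          nlinarith
      _ = (A + B) * u ^ 3 := by ring
      _ ≤ _ := by
        have h3 : 0 ≤ u ^ 3 := by positivity
        have : 0 ≤ (A + B) * u ^ 3 := by positivity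
        have : 0 ≤ (1 / a) * ((A + B) * u ^ 3) := by positivity
        nlinarith

lemma exp_decay {u : ℝ} (hu : 0 < u) : Real.exp (-(u ^ 2) / 8) * (1 + u ^ 3) ≤ 20000 / u ^ 2 := by
  rw [le_div_iff₀ (by positivity)]
  have h := (exp_pow_bounds (x := u ^ 2 / 8) (by positivity)).2.2
  have h1 := Real.one_le_exp (x := u ^ 2 / 8) (by positivity)
  have e1 : Real.exp (u ^ 2 / 8) * Real.exp (-(u ^ 2) / 8) = 1 := by
    rw [← Real.exp_add]; ring_nf; simp
  have t0 := Real.exp_pos (-(u ^ 2) / 8)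
  have h2 : (1 + u ^ 3) * u ^ 2 ≤ 20000 * Real.exp (u ^ 2 / 8) := by
    have : (1 + u ^ 3) * u ^ 2 ≤ 2 + 2 * u ^ 6 := by
      rcases le_total u 1 with q | q
      · have : u ^ 2 ≤ 1 := pow_le_one₀ hu.le q
        have : u ^ 5 ≤ 1 := pow_le_one₀ hu.le q
        have : 0 ≤ u ^ 6 := by positivity
        nlinarith
      · have : u ^ 2 ≤ u ^ 6 := pow_le_pow_right₀ q (by norm_num)
        have : u ^ 5 ≤ u ^ 6 := pow_le_pow_right₀ q (by norm_num)
        nlinarith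
    have e : (u ^ 2 / 8) ^ 3 = u ^ 6 / 512 := by ring
    rw [e] at h
    linarith
  calc _ = ((1 + u ^ 3) * u ^ 2) * Real.exp (-(u ^ 2) / 8) := by ring
    _ ≤ (20000 * Real.exp (u ^ 2 / 8)) * Real.exp (-(u ^ 2) / 8) := by gcongr
    _ = _ := by rw [mul_assoc, e1, mul_one]

/-- The envelope. -/
def env (α A B u : ℝ) : ℝ := Real.exp (-(u ^ 2) / 8) * (u ^ α * (A + B * |Real.log u|))

lemma env_le {α a A B u : ℝ} (ha : 0 < a) (haα : a ≤ α) (hα2 : α ≤ 2)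
    (hA : 0 ≤ A) (hB : 0 ≤ B) (hu : 0 < u) :
    env α A B u ≤ (1 + 1 / a) * (A + B) * (Real.exp (-(u ^ 2) / 8) * (1 + u ^ 3)) := by
  unfold env
  calc _ ≤ Real.exp (-(u ^ 2) / 8) * ((1 + 1 / a) * (A + B) * (1 + u ^ 3)) := by
        exact mul_le_mul_of_nonneg_left (rpow_log_bound ha haα hα2 hA hB hu) (Real.exp_pos _).le
    _ = _ := by ring

lemma osc_far {M : ℝ → ℝ} {a δ α A B y : ℝ} (h : TB M (env α A B)) (ha : 0 < a) (hδ : 0 < δ) 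
    (haα : a ≤ α) (hαδ : α ≤ 2 - 2 * δ) (hA : 0 ≤ A) (hB : 0 ≤ B) (hy : 1 ≤ y) :
    |∫ u in Ioi (0:ℝ), Real.cos (y * u) * M u| ≤
      oscC a δ * (A + B + B * Real.log y) / y ^ (α + 1) := by
  have hy0 : 0 < y := by linarith
  have ly : 0 ≤ Real.log y := Real.log_nonneg hy
  have hS := h.scale (inv_pos.mpr hy0)
  have hp : 0 < y ^ (-α) := Real.rpow_pos_of_pos hy0 _
  have key := (osc1 (α := α) (A := y ^ (-α) * (A + B * Real.log y)) (B := y ^ (-α) * B)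
    (D := (1 + 1 / a) * (A + B) * 20000 * y ^ 2) hS ha hδ haα hαδ (by positivity) (by positivity)
    ?_ ?_).2
  · have e := integral_comp_mul_left_Ioi (fun v => Real.cos v * M (y⁻¹ * v)) 0 hy0
    simp only [mul_zero, inv_mul_cancel_left₀ hy0.ne', smul_eq_mul] at e
    rw [e, abs_mul, abs_of_pos (inv_pos.mpr hy0)]
    calc _ ≤ y⁻¹ * (oscC a δ * (y ^ (-α) * (A + B * Real.log y) + y ^ (-α) * B)) := by gcongr
      _ = _ := by
        rw [Real.rpow_add hy0, Real.rpow_neg hy0.le, Real.rpow_one]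
        field_simp
        ring
  · intro v hv
    have hle : Real.exp (-((y⁻¹ * v) ^ 2) / 8) ≤ 1 := by
      apply Real.exp_le_one_iff.mpr
      have : 0 ≤ (y⁻¹ * v) ^ 2 := by positivity
      linarith
    have hl : |Real.log (y⁻¹ * v)| ≤ Real.log y + |Real.log v| := by
      rw [Real.log_mul (by positivity) hv.ne', Real.log_inv]
      have := abs_add_le (-Real.log y) (Real.log v)
      rwa [abs_neg, abs_of_nonneg ly] at this
    have hr : (y⁻¹ * v) ^ α = y ^ (-α) * v ^ α := by
      rw [Real.mul_rpow (by positivity) hv.le, Real.inv_rpow hy0.le, Real.rpow_neg hy0.le]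
    unfold env
    calc _ ≤ 1 * ((y⁻¹ * v) ^ α * (A + B * (Real.log y + |Real.log v|))) := by gcongr
      _ = _ := by rw [hr]; ring
  · intro v hv
    have hu : 0 < y⁻¹ * v := by positivity
    calc _ ≤ _ := env_le ha haα (by linarith) hA hB hu
      _ ≤ (1 + 1 / a) * (A + B) * (20000 / (y⁻¹ * v) ^ 2) := by
        gcongr; exact exp_decay hu
      _ = _ := by field_simp

/-- constant for the trivial bound -/
def nearC (a : ℝ) : ℝ := (1 + 1 / a) * ∫ u in Ioi (0:ℝ), Real.exp (-(u ^ 2) / 8) * (1 + u ^ 3)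

lemma near_int : IntegrableOn (fun u : ℝ => Real.exp (-(u ^ 2) / 8) * (1 + u ^ 3)) (Ioi 0) := by
  have i0 := integrable_rpow_mul_exp_neg_mul_sq (b := 1/8) (by norm_num) (s := 0) (by norm_num)
  have i3 := integrable_rpow_mul_exp_neg_mul_sq (b := 1/8) (by norm_num) (s := (3:ℕ)) (by norm_num)
  refine (i0.add i3).integrableOn.congr_fun (fun u _ => ?_) measurableSet_Ioi
  simp only [Pi.add_apply, Real.rpow_natCast, Real.rpow_zero]
  have : -(1 / 8) * u ^ 2 = -(u ^ 2) / 8 := by ring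
  rw [this]; ring

lemma osc_near {M : ℝ → ℝ} {a α A B y : ℝ} (h : TB M (env α A B)) (ha : 0 < a)
    (haα : a ≤ α) (hα2 : α ≤ 2) (hA : 0 ≤ A) (hB : 0 ≤ B) :
    |∫ u in Ioi (0:ℝ), Real.cos (y * u) * M u| ≤ nearC a * (A + B) := by
  obtain ⟨F1, F2, F3, h⟩ := h
  have := norm_integral_le_of_norm_le (f := fun u => Real.cos (y * u) * M u)
    (near_int.const_mul ((1 + 1 / a) * (A + B)))
    ((ae_restrict_mem measurableSet_Ioi).mono fun u hu => by
      have h1 := (h u hu).2.1.trans (env_le ha haα hα2 hA hB hu)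
      calc ‖Real.cos (y * u) * M u‖ ≤ 1 * ‖M u‖ := by
            rw [norm_mul]; gcongr; simpa using Real.abs_cos_le_one _
        _ ≤ _ := by simpa using h1)
  rw [integral_const_mul] at this
  calc _ ≤ _ := this
    _ = _ := by unfold nearC; ring

lemma osc_integrable {M : ℝ → ℝ} {a α A B y : ℝ} (h : TB M (env α A B)) (ha : 0 < a)
    (haα : a ≤ α) (hα2 : α ≤ 2) (hA : 0 ≤ A) (hB : 0 ≤ B) :
    IntegrableOn (fun u => Real.cos (y * u) * M u) (Ioi 0) := by
  obtain ⟨F1, F2, F3, h⟩ := h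
  have hNc : ContinuousOn M (Ioi 0) := fun v hv => (h v hv).1.1.continuousAt.continuousWithinAt
  have hgc : ContinuousOn (fun v => Real.cos (y * v) * M v) (Ioi 0) := by fun_prop
  refine (near_int.const_mul ((1 + 1 / a) * (A + B))).mono'
    (hgc.aestronglyMeasurable measurableSet_Ioi) ?_
  refine (ae_restrict_mem measurableSet_Ioi).mono fun u hu => ?_
  have h1 := (h u hu).2.1.trans (env_le ha haα hα2 hA hB hu)
  calc ‖Real.cos (y * u) * M u‖ ≤ 1 * ‖M u‖ := by
        rw [norm_mul]; gcongr; simpa using Real.abs_cos_le_one _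
    _ ≤ _ := by simpa using h1

lemma osc_R {M : ℝ → ℝ} (y : ℝ) : 
    ∫ v : ℝ, Real.cos (y * v) * M |v| = 2 * ∫ u in Ioi (0:ℝ), Real.cos (|y| * u) * M u := by
  rw [← integral_comp_abs (f := fun u => Real.cos (|y| * u) * M u)]
  congr 1; ext v
  rw [← abs_mul, Real.cos_abs]

lemma one_le_log {y : ℝ} (hy : 3 ≤ y) : 1 ≤ Real.log y := by
  rw [Real.le_log_iff_exp_le (by linarith)]
  have := Real.exp_one_lt_d9
  linarith

lemma K_bounds {K : Set ℝ} (hK : IsCompact K) (hKsub : K ⊆ Ioo (0 : ℝ) 2) :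
    ∃ a δ : ℝ, 0 < a ∧ 0 < δ ∧ ∀ α ∈ K, a ≤ α ∧ α ≤ 2 - 2 * δ := by
  rcases K.eq_empty_or_nonempty with rfl | hne
  · exact ⟨1, 1, one_pos, one_pos, by simp⟩
  obtain ⟨x, hx, h1⟩ := hK.exists_isLeast hne
  obtain ⟨z, hz, h2⟩ := hK.exists_isGreatest hne
  refine ⟨x, (2 - z) / 2, (hKsub hx).1, by have := (hKsub hz).2; linarith, fun α hα => ⟨h1 hα, ?_⟩⟩
  have := h2 hα
  linarith

lemma psi_lower {K : Set ℝ} (hK : IsCompact K) (hKsub : K ⊆ Ioo (0 : ℝ) 2)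
    {ψ : ℝ → ℕ → ℝ → ℝ} (hψ : IsPsiFamily ψ) (p : ℕ) :
    ∃ c > (0:ℝ), ∃ C > (0:ℝ), ∀ α ∈ K, ∀ y : ℝ, |y| ≤ 3 → c ≤ ψ α p y ∧ ψ α p y ≤ C := by
  obtain ⟨c, hc, C, h⟩ := hψ.unifBound K hKsub hK p
  refine ⟨min c 1, lt_min hc one_pos, max C 1, by positivity, fun α hα y hy => ?_⟩
  rcases le_total |y| 1 with h1 | h1
  · rw [hψ.eq_one α (hKsub hα) p y h1]; simp
  · exact ⟨(min_le_left _ _).trans (h α hα y h1 hy).1, (h α hα y h1 hy).2.trans (le_max_left _ _)⟩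

lemma osc_psi {K : Set ℝ} (hK : IsCompact K) (hKsub : K ⊆ Ioo (0 : ℝ) 2)
    {ψ : ℝ → ℕ → ℝ → ℝ} (hψ : IsPsiFamily ψ) :
    ∃ C > (0:ℝ), ∀ α ∈ K, ∀ (M : ℝ → ℝ) (A B : ℝ), 0 ≤ A → 0 ≤ B → TB M (env α A B) → ∀ y : ℝ,
      |(∫ v : ℝ, Real.cos (y * v) * M |v| : ℝ)| ≤ C * (A + B) * ψ α 1 y ∧
      (B = 0 → |(∫ v : ℝ, Real.cos (y * v) * M |v| : ℝ)| ≤ C * A * ψ α 0 y) := by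
  obtain ⟨a, δ, ha, hδ, hKab⟩ := K_bounds hK hKsub
  obtain ⟨c0, hc0, _, _, h0⟩ := psi_lower hK hKsub hψ 0
  obtain ⟨c1, hc1, _, _, h1⟩ := psi_lower hK hKsub hψ 1
  have hN : 0 ≤ nearC a := by
    unfold nearC
    refine mul_nonneg (by positivity) (setIntegral_nonneg measurableSet_Ioi fun u hu => ?_)
    have : (0:ℝ) < u := hu
    positivity
  have hO : 0 ≤ oscC a δ := by unfold oscC; positivity
  have q0 : 0 ≤ 2 * nearC a / c0 := by positivity
  have q1 : 0 ≤ 2 * nearC a / c1 := by positivity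
  refine ⟨1 + 4 * oscC a δ + 2 * nearC a / c0 + 2 * nearC a / c1, by positivity, ?_⟩
  intro α hα M A B hA hB hM y
  obtain ⟨haα, hαδ⟩ := hKab α hα
  rw [osc_R, abs_mul, abs_of_pos (two_pos : (0:ℝ) < 2)]
  have p0 := hψ.pos α (hKsub hα) 0 y
  have p1 := hψ.pos α (hKsub hα) 1 y
  set C := 1 + 4 * oscC a δ + 2 * nearC a / c0 + 2 * nearC a / c1 with hC
  rcases le_total |y| 3 with hy | hy
  · have hn := osc_near (y := |y|) hM ha haα (by linarith) hA hB
    constructor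
    · calc _ ≤ 2 * (nearC a * (A + B)) := by gcongr
        _ = (2 * nearC a / c1) * (A + B) * c1 := by field_simp
        _ ≤ C * (A + B) * ψ α 1 y := by
          gcongr
          · linarith
          · exact (h1 α hα y hy).1
    · rintro rfl
      calc _ ≤ 2 * (nearC a * (A + 0)) := by gcongr
        _ = (2 * nearC a / c0) * A * c0 := by field_simp; ring
        _ ≤ C * A * ψ α 0 y := by
          gcongr
          · linarith
          · exact (h0 α hα y hy).1
  · have hf := osc_far (y := |y|) hM ha hδ haα hαδ hA hB (by linarith)
    have hl := one_le_log hy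
    rw [hψ.eq_tail α (hKsub hα) 1 y hy, hψ.eq_tail α (hKsub hα) 0 y hy]
    have hyp : 0 < |y| ^ (α + 1) := Real.rpow_pos_of_pos (by linarith) _
    constructor
    · calc _ ≤ 2 * (oscC a δ * (A + B + B * Real.log |y|) / |y| ^ (α + 1)) := by gcongr
        _ ≤ 2 * (oscC a δ * (2 * (A + B) * Real.log |y|) / |y| ^ (α + 1)) := by
          gcongr
          nlinarith
        _ = (4 * oscC a δ) * (A + B) * (Real.log |y| ^ 1 / |y| ^ (α + 1)) := by ring
        _ ≤ _ := by
          gcongr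
          linarith
    · rintro rfl
      calc _ ≤ 2 * (oscC a δ * (A + 0 + 0 * Real.log |y|) / |y| ^ (α + 1)) := by gcongr
        _ = (2 * oscC a δ) * A * (Real.log |y| ^ 0 / |y| ^ (α + 1)) := by simp; ring
        _ ≤ _ := by
          gcongr
          linarith

section TBs
variable {α w : ℝ}

lemma sq_deriv (u : ℝ) (hu : 0 < u) : HasDerivAt (fun u : ℝ => u ^ 2) (2 * u ^ 2 / u) u := by
  refine (hasDerivAt_pow 2 u).congr_deriv ?_
  field_simp; norm_num

lemma pw_deriv (c : ℝ) (u : ℝ) (hu : 0 < u) :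
    HasDerivAt (fun u : ℝ => c * u ^ α) (α * (c * u ^ α) / u) u := by
  refine ((Real.hasDerivAt_rpow_const (p := α) (Or.inl hu.ne')).const_mul c).congr_deriv ?_
  rw [Real.rpow_sub_one hu.ne']; ring

lemma TB_E : TB (fun u => Real.exp (-(u ^ 2 / 2))) (fun u => 1000 * Real.exp (-(u ^ 2) / 4)) := by
  have := TB.exp_neg (p := fun u : ℝ => u ^ 2 / 2) (α := 2) (by norm_num) le_rfl
    (fun u hu => ((sq_deriv u hu).div_const 2).congr_deriv (by ring)) (fun u _ => by positivity)
  refine this.mono fun u _ => le_of_eq ?_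
  congr 2; ring

lemma exp48 (u : ℝ) : Real.exp (-(u ^ 2) / 4) ≤ Real.exp (-(u ^ 2) / 8) := by
  apply Real.exp_le_exp.mpr; nlinarith [sq_nonneg u]

lemma sq_exp48 (u : ℝ) : u ^ 2 * Real.exp (-(u ^ 2) / 4) ≤ 8 * Real.exp (-(u ^ 2) / 8) := by
  have h := (exp_pow_bounds (x := u ^ 2 / 8) (by positivity)).1
  have e : Real.exp (-(u ^ 2) / 4) = Real.exp (-(u ^ 2) / 8) * Real.exp (-(u ^ 2) / 8) := by
    rw [← Real.exp_add]; ring_nf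
  have e1 : Real.exp (u ^ 2 / 8) * Real.exp (-(u ^ 2) / 8) = 1 := by
    rw [← Real.exp_add]; ring_nf; simp
  have t := Real.exp_pos (-(u ^ 2) / 8)
  calc _ = 8 * (u ^ 2 / 8 * Real.exp (-(u ^ 2) / 8)) * Real.exp (-(u ^ 2) / 8) := by rw [e]; ring
    _ ≤ 8 * (Real.exp (u ^ 2 / 8) * Real.exp (-(u ^ 2) / 8)) * Real.exp (-(u ^ 2) / 8) := by gcongr
    _ = _ := by rw [e1]; ring

lemma TB_f (h0 : 0 < α) (h2 : α ≤ 2) (hw : 0 < w) :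
    TB (fun u => Real.exp (-(u ^ 2 / 2)) * (Real.exp (-(w ^ α * u ^ α)) - 1))
      (env α (10 ^ 10 * w ^ α) 0) := by
  have hwp : 0 < w ^ α := Real.rpow_pos_of_pos hw _
  refine (TB_E.mul (TB.exp_neg_sub h0.le h2 (pw_deriv (w ^ α)) (fun u hu => by positivity))).mono
    fun u hu => ?_
  unfold env
  have hup : 0 < u ^ α := Real.rpow_pos_of_pos hu _
  calc 8 * (1000 * Real.exp (-(u ^ 2) / 4) * (1000 * (w ^ α * u ^ α)))
      ≤ 8 * (1000 * Real.exp (-(u ^ 2) / 8) * (1000 * (w ^ α * u ^ α))) := by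
        gcongr 8 * (1000 * ?_ * _); exact exp48 u
    _ = 8000000 * (Real.exp (-(u ^ 2) / 8) * (u ^ α * w ^ α)) := by ring
    _ ≤ 10 ^ 10 * (Real.exp (-(u ^ 2) / 8) * (u ^ α * w ^ α)) := by gcongr; norm_num
    _ = _ := by ring

lemma TB_g (h0 : 0 < α) (h2 : α ≤ 2) (hw : 0 < w) :
    TB (fun u => (u ^ 2 * Real.exp (-(u ^ 2 / 2))) * (Real.exp (-(w ^ α * u ^ α)) - 1))
      (env α (10 ^ 10 * w ^ α) 0) := by
  have hwp : 0 < w ^ α := Real.rpow_pos_of_pos hw _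
  have tq : TB (fun u : ℝ => u ^ 2) (fun u => 8 * u ^ 2) :=
    TB.pow (α := 2) (by norm_num) le_rfl sq_deriv (fun u _ => by positivity)
  refine ((tq.mul TB_E).mul (TB.exp_neg_sub h0.le h2 (pw_deriv (w ^ α))
    (fun u hu => by positivity))).mono fun u hu => ?_
  unfold env
  have hup : 0 < u ^ α := Real.rpow_pos_of_pos hu _
  calc 8 * (8 * (8 * u ^ 2 * (1000 * Real.exp (-(u ^ 2) / 4))) * (1000 * (w ^ α * u ^ α)))
      = 512000000 * (u ^ 2 * Real.exp (-(u ^ 2) / 4)) * (w ^ α * u ^ α) := by ring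
    _ ≤ 512000000 * (8 * Real.exp (-(u ^ 2) / 8)) * (w ^ α * u ^ α) := by
        gcongr 512000000 * ?_ * _; exact sq_exp48 u
    _ = 4096000000 * (Real.exp (-(u ^ 2) / 8) * (u ^ α * w ^ α)) := by ring
    _ ≤ 10 ^ 10 * (Real.exp (-(u ^ 2) / 8) * (u ^ α * w ^ α)) := by gcongr; norm_num
    _ = _ := by ring

lemma TB_h (h0 : 0 < α) (h2 : α ≤ 2) (hw : 0 < w) :
    TB (fun u => Real.exp (-(u ^ 2 / 2)) * (α * w ^ α * u ^ α * Real.exp (-(w ^ α * u ^ α))))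
      (env α (10 ^ 10 * w ^ α) 0) := by
  have hwp : 0 < w ^ α := Real.rpow_pos_of_pos hw _
  refine (TB_E.mul ((TB.pow h0.le h2 (pw_deriv (α * w ^ α)) (fun u hu => by positivity)).mul 
    (TB.exp_neg h0.le h2 (pw_deriv (w ^ α)) (fun u hu => by positivity)))).mono fun u hu => ?_
  unfold env
  have hup : 0 < u ^ α := Real.rpow_pos_of_pos hu _
  have he : Real.exp (-(w ^ α * u ^ α) / 2) ≤ 1 := by
    apply Real.exp_le_one_iff.mpr
    have : 0 < w ^ α * u ^ α := by positivity
    linarith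
  calc 8 * (1000 * Real.exp (-(u ^ 2) / 4) * (8 * (8 * (α * w ^ α * u ^ α) *
        (1000 * Real.exp (-(w ^ α * u ^ α) / 2)))))
      ≤ 8 * (1000 * Real.exp (-(u ^ 2) / 8) * (8 * (8 * (2 * w ^ α * u ^ α) * (1000 * 1)))) := by
        gcongr 8 * (1000 * ?_ * (8 * (8 * (?_ * _ * _) * (1000 * ?_)))); exact exp48 u
    _ = 1024000000 * (Real.exp (-(u ^ 2) / 8) * (u ^ α * w ^ α)) := by ring
    _ ≤ 10 ^ 10 * (Real.exp (-(u ^ 2) / 8) * (u ^ α * w ^ α)) := by gcongr; norm_num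
    _ = _ := by ring

lemma TB_k (h0 : 0 < α) (h2 : α ≤ 2) (hw : 0 < w) (hw3 : w ≤ 1 / 3) :
    TB (fun u => Real.exp (-(u ^ 2 / 2)) * ((w ^ α * u ^ α * Real.log (w * u)) * 
      Real.exp (-(w ^ α * u ^ α))))
      (env α (10 ^ 10 * w ^ α * (2 * Real.log (1 / w))) (10 ^ 10 * w ^ α)) := by
  have hwp : 0 < w ^ α := Real.rpow_pos_of_pos hw _
  refine (TB_E.mul (((TB.pow h0.le h2 (pw_deriv (w ^ α)) (fun u hu => by positivity)).mul 
    (TB.log.scale hw)).mul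
    (TB.exp_neg h0.le h2 (pw_deriv (w ^ α)) (fun u hu => by positivity)))).mono fun u hu => ?_
  unfold env
  have hup : 0 < u ^ α := Real.rpow_pos_of_pos hu _
  have he : Real.exp (-(w ^ α * u ^ α) / 2) ≤ 1 := by
    apply Real.exp_le_one_iff.mpr
    have : 0 < w ^ α * u ^ α := by positivity
    linarith
  have hL : 1 ≤ Real.log (1 / w) := by
    apply one_le_log; rw [le_div_iff₀ hw]; linarith
  have hl : 1 + |Real.log (w * u)| ≤ 2 * Real.log (1 / w) + |Real.log u| := by
    rw [Real.log_mul hw.ne' hu.ne']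
    have := abs_add_le (Real.log w) (Real.log u)
    have e : |Real.log w| = Real.log (1 / w) := by
      rw [one_div, Real.log_inv, abs_of_neg]
      exact Real.log_neg hw (by linarith)
    linarith
  have a0 := abs_nonneg (Real.log u)
  calc 8 * (1000 * Real.exp (-(u ^ 2) / 4) * (8 * (8 * (8 * (w ^ α * u ^ α) * 
        (1 + |Real.log (w * u)|)) *
        (1000 * Real.exp (-(w ^ α * u ^ α) / 2)))))
      ≤ 8 * (1000 * Real.exp (-(u ^ 2) / 8) * (8 * (8 * (8 * (w ^ α * u ^ α) * 
        (2 * Real.log (1 / w) + |Real.log u|)) * (1000 * 1)))) := by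
        gcongr 8 * (1000 * ?_ * (8 * (8 * (8 * (w ^ α * u ^ α) * ?_) * (1000 * ?_))))
        exact exp48 u
    _ = 4096000000 * (Real.exp (-(u ^ 2) / 8) * (u ^ α * w ^ α * 
        (2 * Real.log (1 / w) + |Real.log u|))) := by ring
    _ ≤ 10 ^ 10 * (Real.exp (-(u ^ 2) / 8) * (u ^ α * w ^ α *
        (2 * Real.log (1 / w) + |Real.log u|))) := by gcongr; norm_num
    _ = _ := by ring

end TBs

lemma abs_wv {α w : ℝ} (hw : 0 < w) (v : ℝ) : |w * v| ^ α = w ^ α * |v| ^ α := by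
  rw [abs_mul, abs_of_pos hw, Real.mul_rpow hw.le (abs_nonneg _)]

lemma f_diff {α w : ℝ} (hα : 0 < α) (hw : 0 < w) (y : ℝ) :
    fFun α y w - gauss y = (2 * Real.pi)⁻¹ * ∫ v : ℝ, Real.cos (y * v) * 
      (fun u => Real.exp (-(u ^ 2 / 2)) * (Real.exp (-(w ^ α * u ^ α)) - 1)) |v| := by
  have ig := integrable_pow_exp 0
  simp only [pow_zero, one_mul] at ig
  have i1 : Integrable (fun u : ℝ => Real.cos (y * u) * Real.exp (-(u ^ 2) / 2)) :=
    ig.bdd_mul (c := 1) (by fun_prop) (ae_of_all _ fun u => by simpa using Real.abs_cos_le_one _)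
  have i2 : Integrable (fun u : ℝ => Real.cos (y * u) * Real.exp (-(u ^ 2) / 2) * 
      Real.exp (-(|w * u| ^ α))) := by
    refine i1.mul_bdd (c := 1) (by
      have := Real.continuous_rpow_const (q := α) hα.le
      exact (Real.continuous_exp.comp ((this.comp (by fun_prop : Continuous fun u : ℝ => |w * u|)).neg)).aestronglyMeasurable)
      (ae_of_all _ fun u => ?_)
    rw [Real.norm_eq_abs, Real.abs_exp, Real.exp_le_one_iff]
    have : 0 ≤ |w * u| ^ α := by positivity
    linarith
  have hg := cos_gauss_fourier y
  have : gauss y = (2 * Real.pi)⁻¹ * ∫ u : ℝ, Real.cos (y * u) * Real.exp (-(u ^ 2) / 2) := by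
    rw [hg]; field_simp
  rw [fFun_eq hα hw, this, ← mul_sub, ← integral_sub i2 i1]
  congr 2; ext v
  rw [abs_wv hw]
  simp only [sq_abs, neg_div]; ring

lemma g_diff {α w : ℝ} (hα : 0 < α) (hw : 0 < w) (y : ℝ) :
    gFun α y w - (1 - y ^ 2) * gauss y = (2 * Real.pi)⁻¹ * ∫ v : ℝ, Real.cos (y * v) * 
      (fun u => (u ^ 2 * Real.exp (-(u ^ 2 / 2))) * (Real.exp (-(w ^ α * u ^ α)) - 1)) |v| := by
  have ig := integrable_pow_exp 2
  have i1 : Integrable (fun u : ℝ => Real.cos (y * u) * (u ^ 2 * Real.exp (-(u ^ 2) / 2))) :=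
    ig.bdd_mul (c := 1) (by fun_prop) (ae_of_all _ fun u => by simpa using Real.abs_cos_le_one _)
  have i2 : Integrable (fun u : ℝ => Real.cos (y * u) * (u ^ 2 * Real.exp (-(u ^ 2) / 2)) * 
      Real.exp (-(|w * u| ^ α))) := by
    refine i1.mul_bdd (c := 1) (by
      have := Real.continuous_rpow_const (q := α) hα.le
      exact (Real.continuous_exp.comp ((this.comp (by fun_prop : Continuous fun u : ℝ => |w * u|)).neg)).aestronglyMeasurable)
      (ae_of_all _ fun u => ?_)
    rw [Real.norm_eq_abs, Real.abs_exp, Real.exp_le_one_iff]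
    have : 0 ≤ |w * u| ^ α := by positivity
    linarith
  have hg := cos_sq_gauss_fourier y
  have : (1 - y ^ 2) * gauss y = 
      (2 * Real.pi)⁻¹ * ∫ u : ℝ, Real.cos (y * u) * (u ^ 2 * Real.exp (-(u ^ 2) / 2)) := by
    rw [hg]; field_simp
  rw [gFun_eq hα hw, this, ← mul_sub, ← integral_sub i2 i1]
  congr 2; ext v
  rw [abs_wv hw]
  simp only [sq_abs, neg_div]; ring

lemma h_rep {α w : ℝ} (hα : 0 < α) (hw : 0 < w) (y : ℝ) :
    hFun α y w = (2 * Real.pi)⁻¹ * ∫ v : ℝ, Real.cos (y * v) * 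
      (fun u => Real.exp (-(u ^ 2 / 2)) * (α * w ^ α * u ^ α * Real.exp (-(w ^ α * u ^ α)))) |v| := by
  rw [hFun_eq hα hw]
  congr 2; ext v
  rw [abs_wv hw]
  simp only [sq_abs, neg_div]; ring

lemma k_rep {α w : ℝ} (hα : 0 < α) (hw : 0 < w) (y : ℝ) :
    kFun α y w = -((2 * Real.pi)⁻¹ * ∫ v : ℝ, Real.cos (y * v) * 
      (fun u => Real.exp (-(u ^ 2 / 2)) * ((w ^ α * u ^ α * Real.log (w * u)) * 
      Real.exp (-(w ^ α * u ^ α)))) |v|) := by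
  rw [kFun_eq hα hw]
  congr 3; ext v
  rw [abs_wv hw, abs_mul, abs_of_pos hw]
  simp only [sq_abs, neg_div]; ring

lemma two_pi_inv_le : (2 * Real.pi)⁻¹ ≤ 1 := by
  apply inv_le_one_of_one_le₀
  have := Real.pi_gt_three
  linarith

lemma abs_twopi (x : ℝ) : |(2 * Real.pi)⁻¹ * x| ≤ |x| := by
  rw [abs_mul, abs_of_pos (by positivity)]
  have := two_pi_inv_le
  have := abs_nonneg x
  nlinarith

/-- The upper bounds from oscillatory integrals. -/
lemma upper_main {K : Set ℝ} (hK : IsCompact K) (hKsub : K ⊆ Ioo (0 : ℝ) 2)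
    {ψ : ℝ → ℕ → ℝ → ℝ} (hψ : IsPsiFamily ψ) :
    ∃ C > (0:ℝ), ∀ α ∈ K, ∀ w ∈ Ioc (0 : ℝ) (1 / 3), ∀ y : ℝ,
      |fFun α y w - gauss y| ≤ C * w ^ α * ψ α 0 y ∧
      |gFun α y w - (1 - y ^ 2) * gauss y| ≤ C * w ^ α * ψ α 0 y ∧
      |hFun α y w| ≤ C * w ^ α * ψ α 0 y ∧
      |kFun α y w| ≤ C * w ^ α * Real.log (1 / w) * ψ α 1 y := by
  obtain ⟨C, hC, h⟩ := osc_psi hK hKsub hψ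
  refine ⟨C * (3 * 10 ^ 10), by positivity, fun α hα w hw y => ?_⟩
  have hα0 := (hKsub hα).1
  have hα2 := (hKsub hα).2.le
  have hw0 := hw.1
  have hwp : 0 < w ^ α := Real.rpow_pos_of_pos hw0 _
  have p0 := hψ.pos α (hKsub hα) 0 y
  have p1 := hψ.pos α (hKsub hα) 1 y
  have hL : 1 ≤ Real.log (1 / w) := by
    apply one_le_log; rw [le_div_iff₀ hw0]; linarith [hw.2]
  have P : 0 < C * w ^ α * ψ α 0 y := by positivity
  refine ⟨?_, ?_, ?_, ?_⟩
  · rw [f_diff hα0 hw0]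
    refine (abs_twopi _).trans (((h α hα _ _ _ (by positivity) le_rfl (TB_f hα0 hα2 hw0) y).2 rfl).trans ?_)
    nlinarith
  · rw [g_diff hα0 hw0]
    refine (abs_twopi _).trans (((h α hα _ _ _ (by positivity) le_rfl (TB_g hα0 hα2 hw0) y).2 rfl).trans ?_)
    nlinarith
  · rw [h_rep hα0 hw0]
    refine (abs_twopi _).trans (((h α hα _ _ _ (by positivity) le_rfl (TB_h hα0 hα2 hw0) y).2 rfl).trans ?_)
    nlinarith
  · rw [k_rep hα0 hw0, abs_neg]
    refine (abs_twopi _).trans (((h α hα _ _ _ (by positivity) (by positivity) 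
      (TB_k hα0 hα2 hw0 hw.2) y).1).trans ?_)
    have : 10 ^ 10 * w ^ α * (2 * Real.log (1 / w)) + 10 ^ 10 * w ^ α ≤ 
      3 * 10 ^ 10 * (w ^ α * Real.log (1 / w)) := by nlinarith
    calc _ ≤ C * (3 * 10 ^ 10 * (w ^ α * Real.log (1 / w))) * ψ α 1 y := by gcongr
      _ = _ := by ring

/-- The Gaussian part of the bound for `g`. -/
lemma sq_gauss_bound {K : Set ℝ} (hK : IsCompact K) (hKsub : K ⊆ Ioo (0 : ℝ) 2)
    {ψ : ℝ → ℕ → ℝ → ℝ} (hψ : IsPsiFamily ψ) :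
    ∃ C > (0:ℝ), ∀ α ∈ K, ∀ w ∈ Ioc (0 : ℝ) (1 / 3), ∀ y : ℝ,
      y ^ 2 * gauss y ≤ C * Real.log (1 / w) * (gauss y + w ^ α * ψ α 0 y) := by
  refine ⟨10000, by positivity, fun α hα w hw y => ?_⟩
  have hα0 := (hKsub hα).1
  have hα2 := (hKsub hα).2.le
  have hw0 := hw.1
  have hwp : 0 < w ^ α := Real.rpow_pos_of_pos hw0 _
  have p0 := hψ.pos α (hKsub hα) 0 y
  have gp := gauss_pos y
  have hL : 1 ≤ Real.log (1 / w) := by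
    apply one_le_log; rw [le_div_iff₀ hw0]; linarith [hw.2]
  rcases le_total (y ^ 2) (9 * Real.log (1 / w)) with h | h
  · have : 0 < w ^ α * ψ α 0 y := by positivity
    calc y ^ 2 * gauss y ≤ (9 * Real.log (1 / w)) * gauss y := by gcongr
      _ ≤ 10000 * Real.log (1 / w) * (gauss y + w ^ α * ψ α 0 y) := by
        gcongr
        · norm_num
        · linarith
  · have hy : 3 ≤ |y| := by
      have : 9 ≤ |y| ^ 2 := by rw [sq_abs]; linarith
      nlinarith [abs_nonneg y]
    rw [hψ.eq_tail α (hKsub hα) 0 y hy, pow_zero]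
    have hy0 : 0 < |y| := by linarith
    have hyp : 0 < |y| ^ (α + 1) := Real.rpow_pos_of_pos hy0 _
    have e1 : |y| ^ (α + 1) ≤ |y| ^ 4 := by
      rw [← Real.rpow_natCast]
      exact Real.rpow_le_rpow_of_exponent_le (by linarith) (by norm_num; linarith)
    have e2 : Real.exp (-(y ^ 2) / 4) ≤ w ^ α := by
      rw [Real.rpow_def_of_pos hw0, Real.exp_le_exp]
      have : Real.log w = - Real.log (1 / w) := by rw [one_div, Real.log_inv]; ring
      rw [this]
      nlinarith
    have e3 : |y| ^ 6 ≤ 500 * Real.exp (y ^ 2 / 4) := by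
      have := (exp_pow_bounds (x := y ^ 2 / 4) (by positivity)).2.2
      have e : |y| ^ 6 = 64 * (y ^ 2 / 4) ^ 3 := by
        rw [show |y| ^ 6 = (|y| ^ 2) ^ 3 by ring, sq_abs]; ring
      rw [e]; linarith [Real.exp_pos (y ^ 2 / 4)]
    have e4 : gauss y ≤ Real.exp (-(y ^ 2) / 4) * Real.exp (-(y ^ 2) / 4) := by
      unfold gauss
      rw [← Real.exp_add, show -(y ^ 2) / 4 + -(y ^ 2) / 4 = -(y ^ 2) / 2 by ring]
      have : (Real.sqrt (2 * Real.pi))⁻¹ ≤ 1 := by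
        apply inv_le_one_of_one_le₀
        rw [Real.one_le_sqrt]
        have := Real.pi_gt_three
        linarith
      have := Real.exp_pos (-(y ^ 2) / 2)
      nlinarith
    have e5 : Real.exp (y ^ 2 / 4) * Real.exp (-(y ^ 2) / 4) = 1 := by
      rw [← Real.exp_add]; ring_nf; simp
    have key : y ^ 2 * gauss y ≤ 500 * (w ^ α * (1 / |y| ^ (α + 1))) := by
      rw [mul_one_div, mul_div_assoc', le_div_iff₀ hyp]
      calc y ^ 2 * gauss y * |y| ^ (α + 1) ≤ |y| ^ 2 * (Real.exp (-(y ^ 2) / 4) * w ^ α) * |y| ^ 4 := by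
            rw [sq_abs]
            gcongr
            exact e4.trans (by gcongr)
        _ = |y| ^ 6 * Real.exp (-(y ^ 2) / 4) * w ^ α := by ring
        _ ≤ (500 * Real.exp (y ^ 2 / 4)) * Real.exp (-(y ^ 2) / 4) * w ^ α := by gcongr
        _ = _ := by rw [mul_assoc 500, e5]; ring
    have Q : 0 < w ^ α * (1 / |y| ^ (α + 1)) := by positivity
    calc _ ≤ _ := key
      _ ≤ 10000 * 1 * (0 + w ^ α * (1 / |y| ^ (α + 1))) := by linarith
      _ ≤ _ := by gcongr

/-- The Gaussian-damped cosine transform. -/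
def AA (m : ℝ → ℝ) (y : ℝ) : ℝ := ∫ u : ℝ, Real.cos (y * u) * (Real.exp (-(u ^ 2) / 2) * m u)

lemma exp_int : Integrable (fun u : ℝ => Real.exp (-(u ^ 2) / 2)) := by
  simpa using integrable_pow_exp 0

lemma em_int {m : ℝ → ℝ} {C : ℝ} (hm : Measurable m) (hb : ∀ u, |m u| ≤ C) :
    Integrable (fun u : ℝ => Real.exp (-(u ^ 2) / 2) * m u) :=
  exp_int.mul_bdd (c := C) hm.aestronglyMeasurable (ae_of_all _ hb)

lemma AA_int {m : ℝ → ℝ} {C : ℝ} (hm : Measurable m) (hb : ∀ u, |m u| ≤ C) (y : ℝ) :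
    Integrable (fun u : ℝ => Real.cos (y * u) * (Real.exp (-(u ^ 2) / 2) * m u)) :=
  (em_int hm hb).bdd_mul (c := 1) (by fun_prop)
    (ae_of_all _ fun u => by simpa using Real.abs_cos_le_one _)

lemma AA_norm_le {m : ℝ → ℝ} (y u : ℝ) : 
    ‖Real.cos (y * u) * (Real.exp (-(u ^ 2) / 2) * m u)‖ ≤ ‖Real.exp (-(u ^ 2) / 2) * m u‖ := by
  rw [norm_mul]
  have := Real.abs_cos_le_one (y * u)
  rw [← Real.norm_eq_abs] at this
  have h2 := norm_nonneg (Real.exp (-(u ^ 2) / 2) * m u)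
  nlinarith

lemma AA_cont {m : ℝ → ℝ} {C : ℝ} (hm : Measurable m) (hb : ∀ u, |m u| ≤ C) :
    Continuous (AA m) := by
  refine continuous_of_dominated (fun y => (AA_int hm hb y).aestronglyMeasurable)
    (fun y => ae_of_all _ fun u => AA_norm_le y u) (em_int hm hb).norm
    (ae_of_all _ fun u => by fun_prop)

lemma AA_bdd {m : ℝ → ℝ} (y : ℝ) {C : ℝ} (hm : Measurable m) (hb : ∀ u, |m u| ≤ C) :
    |AA m y| ≤ ∫ u : ℝ, ‖Real.exp (-(u ^ 2) / 2) * m u‖ :=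
  norm_integral_le_of_norm_le (em_int hm hb).norm (ae_of_all _ fun u => AA_norm_le y u)

structure Good (m : ℝ → ℝ) : Prop where
  meas : Measurable m
  bdd : ∃ C, ∀ u, |m u| ≤ C
  nonneg : ∀ y, 0 ≤ AA m y
  key : ∀ x y, 2 * Real.exp (-(y ^ 2) / 2) * AA m x ≤ AA m (y + x) + AA m (y - x)

lemma AA_one (y : ℝ) : AA (fun _ => 1) y = 2 * Real.pi * gauss y := by
  rw [← cos_gauss_fourier y]; simp [AA]

lemma Good.one : Good (fun _ => 1) where
  meas := measurable_const
  bdd := ⟨1, by simp⟩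
  nonneg y := by rw [AA_one]; have := gauss_pos y; positivity
  key x y := by
    simp only [AA_one]
    have e : gauss (y + x) + gauss (y - x) = 
        2 * Real.exp (-(y ^ 2) / 2) * gauss x * Real.cosh (x * y) := by
      unfold gauss
      have e1 : Real.exp (-((y + x) ^ 2) / 2) = 
          Real.exp (-(y ^ 2) / 2) * Real.exp (-(x ^ 2) / 2) * Real.exp (-(x * y)) := by
        rw [← Real.exp_add, ← Real.exp_add]; ring_nf
      have e2 : Real.exp (-((y - x) ^ 2) / 2) = 
          Real.exp (-(y ^ 2) / 2) * Real.exp (-(x ^ 2) / 2) * Real.exp (x * y) := by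
        rw [← Real.exp_add, ← Real.exp_add]; ring_nf
      rw [Real.cosh_eq, e1, e2]; ring
    have h1 := Real.one_le_cosh (x * y)
    have h2 : 0 < 2 * Real.exp (-(y ^ 2) / 2) * gauss x := by have := gauss_pos x; positivity
    have h3 := Real.pi_pos
    calc _ = 2 * Real.pi * (2 * Real.exp (-(y ^ 2) / 2) * gauss x * 1) := by ring
      _ ≤ 2 * Real.pi * (2 * Real.exp (-(y ^ 2) / 2) * gauss x * Real.cosh (x * y)) := by gcongr
      _ = _ := by rw [← e]; ring

lemma AA_add {m n : ℝ → ℝ} {C D : ℝ} (hm : Measurable m) (hb : ∀ u, |m u| ≤ C) 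
    (hn : Measurable n) (hd : ∀ u, |n u| ≤ D) (y : ℝ) :
    AA (fun u => m u + n u) y = AA m y + AA n y := by
  unfold AA
  rw [← integral_add (AA_int hm hb y) (AA_int hn hd y)]
  congr 1; ext u; ring

lemma AA_smul (m : ℝ → ℝ) (c y : ℝ) : AA (fun u => c * m u) y = c * AA m y := by
  unfold AA
  rw [← integral_const_mul]
  congr 1; ext u; ring

lemma Good.add {m n : ℝ → ℝ} (hm : Good m) (hn : Good n) : Good (fun u => m u + n u) := by
  obtain ⟨C, hC⟩ := hm.bdd
  obtain ⟨D, hD⟩ := hn.bdd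
  have h := AA_add hm.meas hC hn.meas hD
  refine ⟨hm.meas.add hn.meas, ⟨C + D, fun u => (abs_add_le _ _).trans (add_le_add (hC u) (hD u))⟩, 
    fun y => ?_, fun x y => ?_⟩
  · rw [h]; exact add_nonneg (hm.nonneg y) (hn.nonneg y)
  · simp only [h]; have := hm.key x y; have := hn.key x y; linarith

lemma Good.smul {m : ℝ → ℝ} (hm : Good m) {c : ℝ} (hc : 0 ≤ c) : Good (fun u => c * m u) := by
  obtain ⟨C, hC⟩ := hm.bdd
  refine ⟨hm.meas.const_mul c, ⟨c * C, fun u => ?_⟩, fun y => ?_, fun x y => ?_⟩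
  · rw [abs_mul, abs_of_nonneg hc]; exact mul_le_mul_of_nonneg_left (hC u) hc
  · rw [AA_smul]; exact mul_nonneg hc (hm.nonneg y)
  · simp only [AA_smul]
    have := mul_le_mul_of_nonneg_left (hm.key x y) hc
    linarith

lemma AA_tendsto {m : ℕ → ℝ → ℝ} {M : ℝ → ℝ} {C : ℝ} (hm : ∀ n, Measurable (m n))
    (hb : ∀ n u, |m n u| ≤ C) (hl : ∀ u, Tendsto (fun n => m n u) atTop (𝓝 (M u))) (y : ℝ) :
    Tendsto (fun n => AA (m n) y) atTop (𝓝 (AA M y)) := by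
  refine tendsto_integral_of_dominated_convergence (fun u => Real.exp (-(u ^ 2) / 2) * C)
    (fun n => (AA_int (hm n) (hb n) y).aestronglyMeasurable) (exp_int.mul_const C) 
    (fun n => ae_of_all _ fun u => (AA_norm_le y u).trans ?_) (ae_of_all _ fun u => ?_)
  · rw [norm_mul, Real.norm_of_nonneg (Real.exp_pos _).le]
    exact mul_le_mul_of_nonneg_left (hb n u) (Real.exp_pos _).le
  · exact ((hl u).const_mul _).const_mul _

lemma Good.lim {m : ℕ → ℝ → ℝ} {M : ℝ → ℝ} {C : ℝ} (hm : ∀ n, Good (m n))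
    (hb : ∀ n u, |m n u| ≤ C) (hl : ∀ u, Tendsto (fun n => m n u) atTop (𝓝 (M u))) : Good M := by
  have t := AA_tendsto (fun n => (hm n).meas) hb hl
  refine ⟨measurable_of_tendsto_metrizable (fun n => (hm n).meas) (tendsto_pi_nhds.mpr hl), 
    ⟨C, fun u => le_of_tendsto (hl u).abs (Eventually.of_forall fun n => hb n u)⟩, fun y => ?_, fun x y => ?_⟩
  · exact ge_of_tendsto (t y) (Eventually.of_forall fun n => (hm n).nonneg y)
  · exact le_of_tendsto_of_tendsto ((t x).const_mul _) ((t (y + x)).add (t (y - x)))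
      (Eventually.of_forall fun n => (hm n).key x y)

/-- cosine transform of a measure -/
def ct (μ : Measure ℝ) (u : ℝ) : ℝ := ∫ x, Real.cos (u * x) ∂μ

section ct
variable {μ : Measure ℝ} [IsFiniteMeasure μ]

lemma cos_integrable (u : ℝ) : Integrable (fun x => Real.cos (u * x)) μ :=
  (integrable_const (1:ℝ)).mono' (by fun_prop) (ae_of_all _ fun x => by 
    simpa using Real.abs_cos_le_one _)

lemma ct_cont : Continuous (ct μ) := by
  refine continuous_of_dominated (bound := fun _ => 1) (fun y => (cos_integrable y).aestronglyMeasurable)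
    (fun y => ae_of_all _ fun u => by simpa using Real.abs_cos_le_one _) (integrable_const _)
    (ae_of_all _ fun u => by fun_prop)

lemma ct_bdd (u : ℝ) : |ct μ u| ≤ μ.real univ := by
  have := norm_integral_le_of_norm_le (integrable_const (1:ℝ) (μ := μ)) 
    (ae_of_all μ fun x => (by simpa using Real.abs_cos_le_one _ : ‖Real.cos (u * x)‖ ≤ 1))
  simpa [ct] using this

lemma AA_ct {m : ℝ → ℝ} {C : ℝ} (hm : Measurable m) (hb : ∀ u, |m u| ≤ C) (y : ℝ) :
    AA (fun u => m u * ct μ u) y = ∫ z, (1 / 2) * (AA m (y + z) + AA m (y - z)) ∂μ := by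
  have i0 : Integrable (fun p : ℝ × ℝ => 
      (Real.cos (y * p.1) * (Real.exp (-(p.1 ^ 2) / 2) * m p.1)) * Real.cos (p.1 * p.2)) 
      ((volume : Measure ℝ).prod μ) := by
    refine ((AA_int hm hb y).comp_fst μ).mul_bdd (c := 1) (by fun_prop)
      (ae_of_all _ fun p => by simpa using Real.abs_cos_le_one _)
  unfold AA ct
  calc _ = ∫ u : ℝ, ∫ x, (Real.cos (y * u) * (Real.exp (-(u ^ 2) / 2) * m u)) * Real.cos (u * x) ∂μ := by
        congr 1; ext u; rw [integral_const_mul]; ring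
    _ = ∫ x, (∫ u : ℝ, (Real.cos (y * u) * (Real.exp (-(u ^ 2) / 2) * m u)) * Real.cos (u * x)) ∂μ :=
        integral_integral_swap i0
    _ = _ := by
        congr 1; ext x
        rw [← integral_add (AA_int hm hb _) (AA_int hm hb _), ← integral_const_mul]
        congr 1; ext u
        rw [add_mul, sub_mul, Real.cos_add, Real.cos_sub, mul_comm x u]; ring

lemma AA_shift_int {m : ℝ → ℝ} {C : ℝ} (hm : Measurable m) (hb : ∀ u, |m u| ≤ C) (y : ℝ) :
    Integrable (fun z => (1 / 2) * (AA m (y + z) + AA m (y - z))) μ := by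
  have hc := AA_cont hm hb
  refine (integrable_const (∫ u : ℝ, ‖Real.exp (-(u ^ 2) / 2) * m u‖)).mono' 
    (Continuous.aestronglyMeasurable (by fun_prop)) (ae_of_all _ fun z => ?_)
  have h1 := AA_bdd (y + z) hm hb
  have h2 := AA_bdd (y - z) hm hb
  have h3 := abs_add_le (AA m (y + z)) (AA m (y - z))
  rw [Real.norm_eq_abs, abs_mul, abs_of_pos (by norm_num : (0:ℝ) < 1 / 2)]
  linarith

lemma Good.ct {m : ℝ → ℝ} (hm : Good m) : Good (fun u => m u * ct μ u) := by
  obtain ⟨C, hC⟩ := hm.bdd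
  have h := AA_ct (μ := μ) hm.meas hC
  have hi := AA_shift_int (μ := μ) hm.meas hC
  refine ⟨hm.meas.mul ct_cont.measurable, ⟨C * μ.real univ, fun u => abs_mul_le' (hC u) (ct_bdd u)⟩, 
    fun y => ?_, fun x y => ?_⟩
  · rw [h]
    refine integral_nonneg fun z => ?_
    have := hm.nonneg (y + z); have := hm.nonneg (y - z)
    simp only [Pi.zero_apply]; linarith
  · simp only [h]
    rw [← integral_add (hi _) (hi _), ← integral_const_mul]
    refine integral_mono ((hi x).const_mul _) ((hi _).add (hi _)) fun z => ?_
    have h1 := hm.key (x + z) y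
    have h2 := hm.key (x - z) y
    rw [show y + (x + z) = y + x + z by ring, show y - (x + z) = y - x - z by ring] at h1
    rw [show y + (x - z) = y + x - z by ring, show y - (x - z) = y - x + z by ring] at h2
    simp only [Pi.add_apply]
    linarith

lemma Good.ct_pow {m : ℝ → ℝ} (hm : Good m) (n : ℕ) : Good (fun u => m u * LevyLAN.ct μ u ^ n) := by
  induction n with
  | zero => simpa using hm
  | succ n ih => 
    have := ih.ct (μ := μ)
    simpa only [pow_succ, mul_assoc] using this

/-- partial sums -/
def psum (μ : Measure ℝ) (m : ℝ → ℝ) (N : ℕ) (u : ℝ) : ℝ := 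
  ∑ n ∈ Finset.range N, ((n.factorial : ℝ)⁻¹) * (m u * ct μ u ^ n)

lemma psum_succ (m : ℝ → ℝ) (N : ℕ) : psum μ m (N + 1) = 
    fun u => psum μ m N u + ((N.factorial : ℝ)⁻¹) * (m u * ct μ u ^ N) := by
  ext u; simp [psum, Finset.sum_range_succ]

lemma Good.zero : Good (fun _ => 0) := by
  simpa using Good.one.smul (le_refl 0)

lemma Good.psum {m : ℝ → ℝ} (hm : Good m) (N : ℕ) : Good (psum μ m N) := by
  induction N with
  | zero => 
    have : LevyLAN.psum μ m 0 = fun _ => 0 := by ext u; simp [LevyLAN.psum]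
    rw [this]; exact Good.zero
  | succ n ih => 
    rw [psum_succ]
    exact ih.add ((hm.ct_pow n).smul (by positivity))

lemma psum_bdd {m : ℝ → ℝ} {C : ℝ} (hC : ∀ u, |m u| ≤ C) (N : ℕ) (u : ℝ) : 
    |psum μ m N u| ≤ C * Real.exp (μ.real univ) := by
  have h0 : 0 ≤ C := (abs_nonneg _).trans (hC 0)
  have hr : 0 ≤ μ.real univ := measureReal_nonneg
  calc |psum μ m N u| ≤ ∑ n ∈ Finset.range N, |((n.factorial : ℝ)⁻¹) * (m u * ct μ u ^ n)| :=
        Finset.abs_sum_le_sum_abs _ _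
    _ ≤ ∑ n ∈ Finset.range N, C * (μ.real univ ^ n / n.factorial) := by
        refine Finset.sum_le_sum fun n _ => ?_
        rw [abs_mul, abs_of_nonneg (by positivity), abs_mul, abs_pow]
        calc _ ≤ ((n.factorial : ℝ)⁻¹) * (C * μ.real univ ^ n) := by
              gcongr
              · exact hC u
              · exact ct_bdd u
          _ = _ := by ring
    _ = C * ∑ n ∈ Finset.range N, (μ.real univ ^ n / n.factorial) := by rw [Finset.mul_sum]
    _ ≤ _ := by gcongr; exact Real.sum_le_exp_of_nonneg hr N

lemma psum_tendsto (m : ℝ → ℝ) (u : ℝ) : 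
    Tendsto (fun N => psum μ m N u) atTop (𝓝 (m u * Real.exp (ct μ u))) := by
  have h := (NormedSpace.expSeries_div_hasSum_exp (ct μ u)).tendsto_sum_nat
  rw [← Real.exp_eq_exp_ℝ] at h
  have := h.const_mul (m u)
  refine this.congr fun N => ?_
  rw [psum, Finset.mul_sum]
  refine Finset.sum_congr rfl fun n _ => by ring

lemma Good.exp_ct {m : ℝ → ℝ} (hm : Good m) : Good (fun u => m u * Real.exp (LevyLAN.ct μ u)) := by
  obtain ⟨C, hC⟩ := hm.bdd
  exact Good.lim (hm.psum (μ := μ)) (psum_bdd hC) (psum_tendsto m)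

lemma Good.exp_ct_lower {m : ℝ → ℝ} (hm : Good m) (y : ℝ) : 
    AA m y + AA (fun u => m u * LevyLAN.ct μ u) y ≤ AA (fun u => m u * Real.exp (LevyLAN.ct μ u)) y := by
  obtain ⟨C, hC⟩ := hm.bdd
  have t := AA_tendsto (fun N => (hm.psum (μ := μ) N).meas) (psum_bdd hC) (psum_tendsto m) y
  refine ge_of_tendsto t ((eventually_ge_atTop 2).mono fun N hN => ?_)
  induction N, hN using Nat.le_induction with
  | base => 
    obtain ⟨D, hD⟩ := (hm.ct (μ := μ)).bdd
    have e : LevyLAN.psum μ m 2 = fun u => m u + m u * LevyLAN.ct μ u := by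
      ext u; simp [LevyLAN.psum, Finset.sum_range_succ]
    rw [e, AA_add hm.meas hC (hm.ct (μ := μ)).meas hD]
  | succ n hn ih =>
    have g1 := hm.psum (μ := μ) n
    have g2 := (hm.ct_pow (μ := μ) n).smul (c := ((n.factorial : ℝ)⁻¹)) (by positivity)
    obtain ⟨D, hD⟩ := g1.bdd
    obtain ⟨E, hE⟩ := g2.bdd
    rw [psum_succ, AA_add g1.meas hD g2.meas hE]
    have := g2.nonneg y
    linarith

end ct

lemma ct_exp_eq {μ : Measure ℝ} [IsFiniteMeasure μ] (u : ℝ) :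
    Real.exp (-μ.real univ) * Real.exp (ct μ u) = Real.exp (-∫ x, (1 - Real.cos (u * x)) ∂μ) := by
  rw [← Real.exp_add, integral_sub (integrable_const _) (cos_integrable u)]
  simp [ct]; ring_nf

lemma levy_lower {ν : Measure ℝ} (hfin : ∀ ε > 0, ν (Ici ε) < ⊤)
    (hint : ∀ u : ℝ, IntegrableOn (fun x => 1 - Real.cos (u * x)) (Ioi 0) ν) :
    ∃ G : ℝ → ℝ, Good G ∧ (∀ u, Real.exp (-∫ x in Ioi (0:ℝ), (1 - Real.cos (u * x)) ∂ν) ≤ G u) ∧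
      ∀ y, Real.exp (-ν.real (Ici 1)) * (AA G y + 
        ∫ z in Ici (1:ℝ), (1 / 2) * (AA G (y + z) + AA G (y - z)) ∂ν) ≤ 
        AA (fun u => Real.exp (-∫ x in Ioi (0:ℝ), (1 - Real.cos (u * x)) ∂ν)) y := by
  have hc : ∀ u x : ℝ, 0 ≤ 1 - Real.cos (u * x) := fun u x => by linarith [Real.cos_le_one (u * x)]
  let G : ℝ → ℝ := fun u => Real.exp (-∫ x in Ioo (0:ℝ) 1, (1 - Real.cos (u * x)) ∂ν)
  let s : ℕ → Set ℝ := fun n => Ico (1 / ((n:ℝ) + 1)) 1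
  have hsu : (⋃ n, s n) = Ioo 0 1 := by
    ext x
    simp only [s, mem_iUnion, mem_Ico, mem_Ioo]
    constructor
    · rintro ⟨n, h1, h2⟩
      exact ⟨lt_of_lt_of_le (by positivity) h1, h2⟩
    · rintro ⟨h1, h2⟩
      obtain ⟨n, hn⟩ := exists_nat_one_div_lt h1
      exact ⟨n, hn.le, h2⟩
  have hsm : Monotone s := fun i j hij => Ico_subset_Ico_left (by gcongr)
  have hfs : ∀ n, IsFiniteMeasure (ν.restrict (s n)) := fun n => ⟨by
    rw [Measure.restrict_apply_univ]
    exact (measure_mono Ico_subset_Ici_self).trans_lt (hfin _ (by positivity))⟩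
  have hfQ : IsFiniteMeasure (ν.restrict (Ici 1)) := ⟨by
    rw [Measure.restrict_apply_univ]; exact hfin 1 one_pos⟩
  have hG : Good G := by
    refine Good.lim (C := 1) (m := fun n u => Real.exp (-(ν.restrict (s n)).real univ) * 
      (1 * Real.exp (ct (ν.restrict (s n)) u))) (fun n => ?_) (fun n u => ?_) (fun u => ?_)
    · exact (Good.one.exp_ct).smul (Real.exp_pos _).le
    · rw [one_mul, ct_exp_eq, Real.abs_exp, Real.exp_le_one_iff]
      have : 0 ≤ ∫ x in s n, (1 - Real.cos (u * x)) ∂ν := integral_nonneg (hc u)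
      linarith
    · simp only [one_mul, ct_exp_eq]
      refine (Real.continuous_exp.tendsto _).comp (Tendsto.neg ?_)
      have := tendsto_setIntegral_of_monotone (μ := ν) (f := fun x => 1 - Real.cos (u * x)) (s := s)
        (fun n => measurableSet_Ico) hsm 
        (by rw [hsu]; exact (hint u).mono_set Ioo_subset_Ioi_self)
      rwa [hsu] at this
  have hsplit : ∀ u, ∫ x in Ioi (0:ℝ), (1 - Real.cos (u * x)) ∂ν = 
      (∫ x in Ioo (0:ℝ) 1, (1 - Real.cos (u * x)) ∂ν) + ∫ x in Ici (1:ℝ), (1 - Real.cos (u * x)) ∂ν := by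
    intro u
    rw [← setIntegral_union ?_ measurableSet_Ici ((hint u).mono_set Ioo_subset_Ioi_self) 
      ((hint u).mono_set (fun x hx => lt_of_lt_of_le one_pos hx)), Ioo_union_Ici_eq_Ioi one_pos]
    rw [Set.disjoint_left]
    intro x hx hx'
    exact absurd hx.2 (not_lt.mpr hx')
  have hQ0 : ∀ u, 0 ≤ ∫ x in Ici (1:ℝ), (1 - Real.cos (u * x)) ∂ν := fun u => integral_nonneg (hc u)
  refine ⟨G, hG, fun u => ?_, fun y => ?_⟩
  · apply Real.exp_le_exp.mpr
    rw [hsplit]; linarith [hQ0 u]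
  · obtain ⟨C, hC⟩ := hG.bdd
    rw [← AA_ct (μ := ν.restrict (Ici 1)) hG.meas hC]
    have h := hG.exp_ct_lower (μ := ν.restrict (Ici 1)) y
    have e : (fun u => Real.exp (-∫ x in Ioi (0:ℝ), (1 - Real.cos (u * x)) ∂ν)) = 
      fun u => Real.exp (-ν.real (Ici 1)) * (G u * Real.exp (ct (ν.restrict (Ici 1)) u)) := by
      ext u
      have := ct_exp_eq (μ := ν.restrict (Ici 1)) u
      rw [measureReal_restrict_apply_univ] at this
      rw [hsplit, neg_add, Real.exp_add, ← this]
      simp only [G]; ring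
    rw [e, AA_smul]
    exact mul_le_mul_of_nonneg_left h (Real.exp_pos _).le

/-- stable Levy integral -/
def stI (α : ℝ) : ℝ := ∫ x in Ioi (0:ℝ), (1 - Real.cos x) * x ^ (-1 - α)

/-- dominating function -/
def stD (a b x : ℝ) : ℝ := if x ≤ 1 then x ^ (1 - b) else 2 * x ^ (-1 - a)

lemma stD_int {a b : ℝ} (ha : 0 < a) (hb : b < 2) : IntegrableOn (stD a b) (Ioi 0) := by
  rw [← Ioc_union_Ioi_eq_Ioi (zero_le_one' ℝ)]
  refine IntegrableOn.union ?_ ?_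
  · have h := (intervalIntegral.intervalIntegrable_rpow' (a := 0) (b := 1) (r := 1 - b) (by linarith))
    rw [intervalIntegrable_iff_integrableOn_Ioc_of_le zero_le_one] at h
    refine h.congr_fun (fun x hx => ?_) measurableSet_Ioc
    simp [stD, hx.2]
  · have h : IntegrableOn (fun x : ℝ => 2 * x ^ (-1 - a)) (Ioi 1) := 
      (integrableOn_Ioi_rpow_of_lt (a := -1 - a) (by linarith) (c := 1) one_pos).const_mul 2
    refine h.congr_fun (fun x hx => ?_) measurableSet_Ioi
    have : ¬ x ≤ 1 := not_le.mpr hx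
    simp [stD, this]

lemma st_le {a b α x : ℝ} (haα : a ≤ α) (hαb : α ≤ b) (hx : 0 < x) :
    (1 - Real.cos x) * x ^ (-1 - α) ≤ stD a b x := by
  unfold stD
  have hp : 0 < x ^ (-1 - α) := Real.rpow_pos_of_pos hx _
  split_ifs with h
  · have h1 : 1 - Real.cos x ≤ x ^ 2 := by
      have := Real.one_sub_sq_div_two_le_cos (x := x)
      nlinarith [sq_nonneg x]
    calc _ ≤ x ^ 2 * x ^ (-1 - α) := by gcongr
      _ = x ^ (1 - α) := by
        rw [← Real.rpow_natCast, ← Real.rpow_add hx]; congr 1; norm_num; ring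
      _ ≤ x ^ (1 - b) := Real.rpow_le_rpow_of_exponent_ge hx h (by linarith)
  · have h1 : 1 - Real.cos x ≤ 2 := by linarith [Real.neg_one_le_cos x]
    calc _ ≤ 2 * x ^ (-1 - α) := by gcongr
      _ ≤ 2 * x ^ (-1 - a) := by
        gcongr
        · exact (not_le.mp h).le

lemma st_int {α : ℝ} (h0 : 0 < α) (h2 : α < 2) : 
    IntegrableOn (fun x => (1 - Real.cos x) * x ^ (-1 - α)) (Ioi 0) := by
  refine (stD_int h0 h2).mono' (Measurable.aestronglyMeasurable (by fun_prop)) 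
    ((ae_restrict_mem measurableSet_Ioi).mono fun x hx => ?_)
  have hx : 0 < x := hx
  have hp : 0 < x ^ (-1 - α) := Real.rpow_pos_of_pos hx _
  rw [Real.norm_of_nonneg (mul_nonneg (by linarith [Real.cos_le_one x]) hp.le)]
  exact st_le le_rfl le_rfl hx

lemma stI_upper {a b α : ℝ} (ha : 0 < a) (hb : b < 2) (haα : a ≤ α) (hαb : α ≤ b) :
    stI α ≤ ∫ x in Ioi (0:ℝ), stD a b x :=
  setIntegral_mono_on (st_int (by linarith) (by linarith)) (stD_int ha hb) measurableSet_Ioi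
    fun _ hx => st_le haα hαb hx

lemma stI_lower {α : ℝ} (h0 : 0 < α) (h2 : α < 2) : 1 / 18 ≤ stI α := by
  have hpos : ∀ x ∈ Ioi (0:ℝ), 0 ≤ (1 - Real.cos x) * x ^ (-1 - α) := fun x hx => 
    mul_nonneg (by linarith [Real.cos_le_one x]) (Real.rpow_pos_of_pos hx _).le
  have hsub : Icc (1:ℝ) 2 ⊆ Ioi 0 := fun x hx => lt_of_lt_of_le one_pos hx.1
  have h1 : ∫ x in Icc (1:ℝ) 2, (1 - Real.cos x) * x ^ (-1 - α) ≤ stI α :=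
    setIntegral_mono_set (st_int h0 h2) ((ae_restrict_mem measurableSet_Ioi).mono hpos) 
      hsub.eventuallyLE
  have h3 : ∫ x in Icc (1:ℝ) 2, (1 / 18 : ℝ) ≤ ∫ x in Icc (1:ℝ) 2, (1 - Real.cos x) * x ^ (-1 - α) := by
    refine setIntegral_mono_on (by simp) ((st_int h0 h2).mono_set hsub) measurableSet_Icc
      fun x hx => ?_
    have hx0 : 0 < x := by linarith [hx.1]
    have e1 : Real.cos x ≤ 5 / 9 := by
      refine le_trans (Real.cos_le_cos_of_nonneg_of_le_pi zero_le_one ?_ hx.1) Real.cos_one_le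
      linarith [hx.2, Real.pi_gt_three]
    have e2 : (1 / 8 : ℝ) ≤ x ^ (-1 - α) := by
      calc (1 / 8 : ℝ) = 2 ^ (-3 : ℝ) := by
            rw [Real.rpow_neg (by norm_num)]; norm_num
        _ ≤ 2 ^ (-1 - α) := Real.rpow_le_rpow_of_exponent_le (by norm_num) (by linarith)
        _ ≤ x ^ (-1 - α) := Real.rpow_le_rpow_of_nonpos hx0 hx.2 (by linarith)
    nlinarith
  have : ∫ x in Icc (1:ℝ) 2, (1 / 18 : ℝ) = 1 / 18 := by simp; norm_num
  linarith

lemma st_scale {α : ℝ} (h0 : 0 < α) (u : ℝ) :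
    ∫ x in Ioi (0:ℝ), (1 - Real.cos (u * x)) * x ^ (-1 - α) = |u| ^ α * stI α := by
  rcases eq_or_ne u 0 with rfl | hu
  · simp [h0.ne']
  have hu' : 0 < |u| := abs_pos.mpr hu
  have e := integral_comp_mul_left_Ioi (fun x => (1 - Real.cos x) * x ^ (-1 - α)) 0 hu'
  simp only [mul_zero, smul_eq_mul] at e
  have : ∫ x in Ioi (0:ℝ), (1 - Real.cos (u * x)) * x ^ (-1 - α) = 
     ∫ x in Ioi (0:ℝ), |u| ^ (1 + α) * ((1 - Real.cos (|u| * x)) * (|u| * x) ^ (-1 - α)) := by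
    refine setIntegral_congr_fun measurableSet_Ioi fun x hx => ?_
    have hx : 0 < x := hx
    have hcos : Real.cos (|u| * x) = Real.cos (u * x) := by
      rw [← Real.cos_abs (u * x), abs_mul, abs_of_pos hx]
    rw [hcos, Real.mul_rpow hu'.le hx.le, show -1 - α = -(1 + α) by ring, Real.rpow_neg hu'.le]
    have : 0 < |u| ^ (1 + α) := Real.rpow_pos_of_pos hu' _
    field_simp
  rw [this, integral_const_mul, e, stI, Real.rpow_add hu', Real.rpow_one]
  field_simp

lemma st_scale_int {α : ℝ} (h0 : 0 < α) (h2 : α < 2) (u : ℝ) :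
    IntegrableOn (fun x => (1 - Real.cos (u * x)) * x ^ (-1 - α)) (Ioi 0) := by
  rcases eq_or_ne u 0 with rfl | hu
  · simp
  refine Integrable.of_integral_ne_zero ?_
  rw [st_scale h0]
  have := stI_lower h0 h2
  have hu' : 0 < |u| := abs_pos.mpr hu
  have : 0 < |u| ^ α := Real.rpow_pos_of_pos hu' _
  positivity

/-- The (one-sided) stable Levy measure. -/
def levy (κ α : ℝ) : Measure ℝ := volume.withDensity fun x => ENNReal.ofReal (κ * x ^ (-1 - α))

section levy
variable {κ α : ℝ}

lemma levy_meas : Measurable fun x : ℝ => ENNReal.ofReal (κ * x ^ (-1 - α)) := by fun_prop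

lemma levy_integral (hκ : 0 ≤ κ) {s : Set ℝ} (hs : MeasurableSet s) (hs0 : s ⊆ Ioi 0) (g : ℝ → ℝ) :
    ∫ x in s, g x ∂(levy κ α) = ∫ x in s, g x * (κ * x ^ (-1 - α)) := by
  rw [levy, restrict_withDensity hs, integral_withDensity_eq_integral_toReal_smul levy_meas 
    (ae_of_all _ fun x => ENNReal.ofReal_lt_top)]
  refine setIntegral_congr_fun hs fun x hx => ?_
  have : 0 < x ^ (-1 - α) := Real.rpow_pos_of_pos (hs0 hx) _
  simp only [smul_eq_mul]
  rw [ENNReal.toReal_ofReal (by positivity), mul_comm]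

lemma levy_integrable (hκ : 0 ≤ κ) {s : Set ℝ} (hs : MeasurableSet s) (hs0 : s ⊆ Ioi 0) {g : ℝ → ℝ} 
    (h : IntegrableOn (fun x => g x * (κ * x ^ (-1 - α))) s) : IntegrableOn g s (levy κ α) := by
  rw [IntegrableOn, levy, restrict_withDensity hs, integrable_withDensity_iff levy_meas 
    (ae_of_all _ fun x => ENNReal.ofReal_lt_top)]
  refine IntegrableOn.congr_fun h (fun x hx => ?_) hs
  have : 0 < x ^ (-1 - α) := Real.rpow_pos_of_pos (hs0 hx) _
  rw [ENNReal.toReal_ofReal (by positivity)]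

lemma pow_int (h0 : 0 < α) {ε : ℝ} (hε : 0 < ε) : 
    IntegrableOn (fun x : ℝ => κ * x ^ (-1 - α)) (Ici ε) := by
  rw [integrableOn_Ici_iff_integrableOn_Ioi]
  exact (integrableOn_Ioi_rpow_of_lt (by linarith) hε).const_mul κ

lemma levy_fin (h0 : 0 < α) {ε : ℝ} (hε : 0 < ε) : levy κ α (Ici ε) < ⊤ := by
  rw [levy, withDensity_apply _ measurableSet_Ici]
  exact (pow_int h0 hε).lintegral_lt_top

lemma levy_real (hκ : 0 ≤ κ) {s : Set ℝ} (hs : MeasurableSet s) (hs0 : s ⊆ Ioi 0) :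
    (levy κ α).real s = ∫ x in s, κ * x ^ (-1 - α) := by
  have := levy_integral (α := α) hκ hs hs0 (fun _ => 1)
  simpa using this

lemma levy_Ici (hκ : 0 ≤ κ) (h0 : 0 < α) : (levy κ α).real (Ici 1) = κ / α := by
  rw [levy_real hκ measurableSet_Ici (fun x hx => lt_of_lt_of_le (one_pos : (0:ℝ) < 1) hx), 
    integral_Ici_eq_integral_Ioi, integral_const_mul, integral_Ioi_rpow_of_lt (by linarith) one_pos]
  simp
  have : -1 - α + 1 = -α := by ring
  rw [this]; field_simp

lemma levy_Icc (hκ : 0 ≤ κ) (h0 : 0 < α) (h2 : α ≤ 2) {y : ℝ} (hy : 1 ≤ y) : 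
    κ / (8 * y ^ (α + 1)) ≤ (levy κ α).real (Icc y (y + 1)) := by
  have hy0 : 0 < y := by linarith
  have hsub : Icc y (y + 1) ⊆ Ici y := fun x hx => hx.1
  rw [levy_real hκ measurableSet_Icc (fun x hx => lt_of_lt_of_le hy0 hx.1)]
  have h1 : ∫ x in Icc y (y + 1), κ / (8 * y ^ (α + 1)) = κ / (8 * y ^ (α + 1)) := by simp
  rw [← h1]
  refine setIntegral_mono_on (integrableOn_const (by simp)) ((pow_int h0 hy0).mono_set hsub) measurableSet_Icc fun x hx => ?_
  have hx0 : 0 < x := by linarith [hx.1]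
  rw [div_eq_mul_inv]
  refine mul_le_mul_of_nonneg_left ?_ hκ
  rw [show -1 - α = -(α + 1) by ring, Real.rpow_neg hx0.le]
  have hxp : 0 < x ^ (α + 1) := Real.rpow_pos_of_pos hx0 _
  refine inv_anti₀ hxp ?_
  calc x ^ (α + 1) ≤ (2 * y) ^ (α + 1) := by
        refine Real.rpow_le_rpow hx0.le ?_ (by linarith); linarith [hx.2]
    _ = 2 ^ (α + 1) * y ^ (α + 1) := Real.mul_rpow (by norm_num) hy0.le
    _ ≤ 2 ^ (3:ℝ) * y ^ (α + 1) := by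
        gcongr
        · norm_num
        · linarith
    _ = _ := by norm_num

end levy

lemma AA_even (m : ℝ → ℝ) (y : ℝ) : AA m |y| = AA m y := by
  unfold AA
  congr 1; ext u
  rcases abs_choice y with h | h <;> rw [h]
  rw [neg_mul, Real.cos_neg]

lemma fFun_AA {α w : ℝ} (hα : 0 < α) (hw : 0 < w) (y : ℝ) :
    fFun α y w = (2 * Real.pi)⁻¹ * AA (fun u => Real.exp (-(|w * u| ^ α))) y := by
  rw [fFun_eq hα hw, AA]; simp only [mul_assoc]

lemma Good.zero_le {G : ℝ → ℝ} (hG : Good G) (y : ℝ) : 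
    Real.exp (-(y ^ 2) / 2) * AA G 0 ≤ AA G y := by
  have := hG.key 0 y
  simp only [add_zero, sub_zero] at this
  linarith

lemma AA_m_zero {α w : ℝ} {G : ℝ → ℝ} (hα : 0 < α) (hw : 0 < w) (hw1 : w ≤ 1) (hG : Good G)
    (h : ∀ u, Real.exp (-(|w * u| ^ α)) ≤ G u) : Real.exp (-2) ≤ AA G 0 := by
  obtain ⟨C, hC⟩ := hG.bdd
  have hi := AA_int hG.meas hC 0
  unfold AA
  have h0 : ∀ u, 0 ≤ Real.cos (0 * u) * (Real.exp (-(u ^ 2) / 2) * G u) := fun u => by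
    have := (Real.exp_pos _).le.trans (h u)
    simp only [zero_mul, Real.cos_zero]; positivity
  refine le_trans ?_ (setIntegral_le_integral (s := Icc (0:ℝ) 1) hi (ae_of_all _ h0))
  have h1 : ∫ x in Icc (0:ℝ) 1, Real.exp (-2) = Real.exp (-2) := by simp
  rw [← h1]
  refine setIntegral_mono_on (integrableOn_const (by simp)) hi.integrableOn measurableSet_Icc fun u hu => ?_
  have e1 : Real.exp (-2) = Real.exp (-1) * Real.exp (-1) := by rw [← Real.exp_add]; norm_num
  rw [e1, zero_mul, Real.cos_zero, one_mul]
  have e2 : |w * u| ^ α ≤ 1 := by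
    refine Real.rpow_le_one (abs_nonneg _) ?_ hα.le
    rw [abs_of_nonneg (mul_nonneg hw.le hu.1)]
    nlinarith [hu.1, hu.2]
  refine mul_le_mul ?_ (le_trans ?_ (h u)) (Real.exp_pos _).le (Real.exp_pos _).le
  · apply Real.exp_le_exp.mpr; nlinarith [hu.1, hu.2]
  · apply Real.exp_le_exp.mpr; linarith

lemma f_lower {a b : ℝ} (ha : 0 < a) (hb : b < 2) : ∃ c > (0:ℝ), ∀ α w y : ℝ, a ≤ α → α ≤ b → 0 < w → w ≤ 1 →
    c * gauss y ≤ fFun α y w ∧ (1 ≤ |y| → c * (w ^ α / |y| ^ (α + 1)) ≤ fFun α y w) := by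
  let I1 := 1 + |∫ x in Ioi (0:ℝ), stD a b x|
  have hI1 : 0 < I1 := by positivity
  let c1 := (2 * Real.pi)⁻¹ * Real.exp (-(18 / a)) * Real.exp (-2)
  have hc1 : 0 < c1 := by positivity
  let c2 := (1 / 2) * Real.exp (-(1 / 2)) * (1 / 8) / I1
  have hc2 : 0 < c2 := by positivity
  refine ⟨min c1 (c1 * c2), by positivity, fun α w y haα hαb hw hw1 => ?_⟩
  have h0 : 0 < α := by linarith
  have h2 : α < 2 := by linarith
  have hI := stI_lower h0 h2
  have hI0 : 0 < stI α := by linarith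
  have hIu : stI α ≤ I1 := (stI_upper ha hb haα hαb).trans ((le_abs_self _).trans (by simp [I1]))
  have hwp : 0 < w ^ α := Real.rpow_pos_of_pos hw _
  have hwp1 : w ^ α ≤ 1 := Real.rpow_le_one hw.le hw1 h0.le
  let κ := w ^ α / stI α
  have hκ : 0 < κ := by positivity
  have hκ18 : κ ≤ 18 := by
    rw [div_le_iff₀ hI0]; linarith
  have hκl : w ^ α / I1 ≤ κ := by simp only [κ]; gcongr
  have hint : ∀ u : ℝ, IntegrableOn (fun x => 1 - Real.cos (u * x)) (Ioi 0) (levy κ α) := fun u => by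
    refine levy_integrable hκ.le measurableSet_Ioi subset_rfl ?_
    have : IntegrableOn (fun x => κ * ((1 - Real.cos (u * x)) * x ^ (-1 - α))) (Ioi 0) := 
      (st_scale_int h0 h2 u).const_mul κ
    refine this.congr_fun (fun x _ => ?_) measurableSet_Ioi
    ring
  have hval : ∀ u : ℝ, ∫ x in Ioi (0:ℝ), (1 - Real.cos (u * x)) ∂(levy κ α) = |w * u| ^ α := fun u => by
    rw [levy_integral hκ.le measurableSet_Ioi subset_rfl]
    have : ∫ x in Ioi (0:ℝ), (1 - Real.cos (u * x)) * (κ * x ^ (-1 - α)) = 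
       ∫ x in Ioi (0:ℝ), κ * ((1 - Real.cos (u * x)) * x ^ (-1 - α)) := by
      congr 1; ext x; ring
    rw [this, integral_const_mul, st_scale h0, abs_wv hw]
    simp only [κ]; field_simp
  obtain ⟨G, hG, hGm, hGl⟩ := levy_lower (ν := levy κ α) (fun ε hε => levy_fin h0 hε) hint
  simp only [hval, levy_Ici hκ.le h0] at hGm hGl
  have hG0 := AA_m_zero h0 hw hw1 hG hGm
  have hΛ : Real.exp (-(18 / a)) ≤ Real.exp (-(κ / α)) := by
    apply Real.exp_le_exp.mpr
    have : κ / α ≤ 18 / a := div_le_div₀ (by norm_num) hκ18 ha haα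
    linarith
  have hpi : (0:ℝ) < (2 * Real.pi)⁻¹ := by positivity
  rw [fFun_AA h0 hw]
  have hintg : ∀ z, 0 ≤ (1 / 2) * (AA G (|y| + z) + AA G (|y| - z)) := fun z => by
    have := hG.nonneg (|y| + z); have := hG.nonneg (|y| - z); linarith
  have hJ : 0 ≤ ∫ z in Ici (1:ℝ), (1 / 2) * (AA G (|y| + z) + AA G (|y| - z)) ∂(levy κ α) :=
    integral_nonneg hintg
  have hl := hGl |y|
  rw [AA_even _ y, AA_even] at hl
  constructor
  · have e1 : gauss y ≤ Real.exp (-(y ^ 2) / 2) := by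
      unfold gauss
      have : (Real.sqrt (2 * Real.pi))⁻¹ ≤ 1 := by
        apply inv_le_one_of_one_le₀
        rw [Real.one_le_sqrt]
        have := Real.pi_gt_three
        linarith
      have := Real.exp_pos (-(y ^ 2) / 2)
      nlinarith
    have gp := gauss_pos y
    have e2 := hG.zero_le y
    calc _ ≤ c1 * gauss y := by gcongr; exact min_le_left _ _
      _ = (2 * Real.pi)⁻¹ * (Real.exp (-(18 / a)) * (gauss y * Real.exp (-2))) := by
        simp only [c1]; ring
      _ ≤ (2 * Real.pi)⁻¹ * (Real.exp (-(κ / α)) * (Real.exp (-(y ^ 2) / 2) * AA G 0)) := by gcongr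
      _ ≤ (2 * Real.pi)⁻¹ * (Real.exp (-(κ / α)) * (AA G y + 
        ∫ z in Ici (1:ℝ), (1 / 2) * (AA G (|y| + z) + AA G (|y| - z)) ∂(levy κ α))) := by
        gcongr; linarith
      _ ≤ _ := by gcongr
  · intro hy
    have hy0 : 0 < |y| := by linarith
    have hyp : 0 < |y| ^ (α + 1) := Real.rpow_pos_of_pos hy0 _
    obtain ⟨C, hC⟩ := hG.bdd
    have hfQ : IsFiniteMeasure ((levy κ α).restrict (Ici 1)) := ⟨by
      rw [Measure.restrict_apply_univ]; exact levy_fin h0 one_pos⟩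
    have iQ : IntegrableOn (fun z => (1 / 2) * (AA G (|y| + z) + AA G (|y| - z))) (Ici 1) (levy κ α) :=
      AA_shift_int hG.meas hC |y|
    have hsub : Icc |y| (|y| + 1) ⊆ Ici 1 := fun x hx => hy.trans hx.1
    have j1 : ∫ z in Icc |y| (|y| + 1), (1 / 2) * (AA G (|y| + z) + AA G (|y| - z)) ∂(levy κ α) ≤
        ∫ z in Ici (1:ℝ), (1 / 2) * (AA G (|y| + z) + AA G (|y| - z)) ∂(levy κ α) :=
      setIntegral_mono_set iQ (ae_of_all _ hintg) hsub.eventuallyLE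
    have j2 : ∫ z in Icc |y| (|y| + 1), ((1 / 2) * (Real.exp (-(1 / 2)) * AA G 0)) ∂(levy κ α) ≤ 
        ∫ z in Icc |y| (|y| + 1), (1 / 2) * (AA G (|y| + z) + AA G (|y| - z)) ∂(levy κ α) := by
      refine setIntegral_mono_on (integrableOn_const 
        ((measure_mono hsub).trans_lt (levy_fin h0 one_pos)).ne) (iQ.mono_set hsub) 
        measurableSet_Icc fun z hz => ?_
      have k1 := hG.nonneg (|y| + z)
      have k2 := hG.zero_le (|y| - z)
      have k3 : Real.exp (-(1 / 2)) ≤ Real.exp (-((|y| - z) ^ 2) / 2) := by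
        apply Real.exp_le_exp.mpr; nlinarith [hz.1, hz.2]
      have k4 := mul_le_mul_of_nonneg_right k3 (hG.nonneg 0)
      linarith
    rw [setIntegral_const, smul_eq_mul] at j2
    have j3 := levy_Icc hκ.le h0 h2.le hy
    have hJ' : (w ^ α / I1) / (8 * |y| ^ (α + 1)) * ((1 / 2) * (Real.exp (-(1 / 2)) * Real.exp (-2))) ≤ 
        ∫ z in Ici (1:ℝ), (1 / 2) * (AA G (|y| + z) + AA G (|y| - z)) ∂(levy κ α) := by
      refine le_trans ?_ (j2.trans j1)
      gcongr
      exact le_trans (by gcongr) j3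
    have gn := hG.nonneg y
    calc _ ≤ (c1 * c2) * (w ^ α / |y| ^ (α + 1)) := by gcongr; exact min_le_right _ _
      _ = (2 * Real.pi)⁻¹ * (Real.exp (-(18 / a)) * ((w ^ α / I1) / (8 * |y| ^ (α + 1)) * ((1 / 2) * (Real.exp (-(1 / 2)) * Real.exp (-2))))) := by
        simp only [c1, c2]; field_simp
      _ ≤ (2 * Real.pi)⁻¹ * (Real.exp (-(κ / α)) * (AA G y + 
        ∫ z in Ici (1:ℝ), (1 / 2) * (AA G (|y| + z) + AA G (|y| - z)) ∂(levy κ α))) := by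
        gcongr; linarith
      _ ≤ _ := by gcongr

/-- uniform bounds for `f_α, g_α, h_α, k_α`. -/
theorem statement8 (K : Set ℝ) (hK : IsCompact K) (hKsub : K ⊆ Set.Ioo (0 : ℝ) 2)
    (ψ : ℝ → ℕ → ℝ → ℝ) (hψ : IsPsiFamily ψ) :
    ∃ C > (0 : ℝ), ∀ α ∈ K, ∀ w ∈ Set.Ioc (0 : ℝ) (1 / 3), ∀ y : ℝ,
      (1 / C * (gauss y + w ^ α * ψ α 0 y) ≤ fFun α y w ∧
        fFun α y w ≤ C * (gauss y + w ^ α * ψ α 0 y)) ∧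
      |gFun α y w| ≤ C * Real.log (1 / w) * (gauss y + w ^ α * ψ α 0 y) ∧
      |hFun α y w| ≤ C * w ^ α * ψ α 0 y ∧
      |kFun α y w| ≤ C * w ^ α * Real.log (1 / w) * ψ α 1 y := by
  obtain ⟨a, δ, ha, hδ, hKab⟩ := K_bounds hK hKsub
  obtain ⟨C1, hC1, hup⟩ := upper_main hK hKsub hψ
  obtain ⟨C2, hC2, hsq⟩ := sq_gauss_bound hK hKsub hψ
  obtain ⟨c, hc, hlow⟩ := f_lower (b := 2 - 2 * δ) ha (by linarith)
  obtain ⟨_, _, P, hP, hps⟩ := psi_lower hK hKsub hψ 0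
  have g3 := gauss_pos 3
  let C3 := 1 / c + 1 / c * (1 + P / gauss 3)
  have hC3 : 0 < C3 := by positivity
  refine ⟨1 + C1 + C2 + C3, by positivity, fun α hα w hw y => ?_⟩
  have hα0 := (hKsub hα).1
  have hα2 := (hKsub hα).2.le
  have hw0 := hw.1
  have hwp : 0 < w ^ α := Real.rpow_pos_of_pos hw0 _
  have hwp1 : w ^ α ≤ 1 := Real.rpow_le_one hw0.le (by linarith [hw.2]) hα0.le
  have p0 := hψ.pos α (hKsub hα) 0 y
  have p1 := hψ.pos α (hKsub hα) 1 y
  have gp := gauss_pos y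
  have hL : 1 ≤ Real.log (1 / w) := by
    apply one_le_log; rw [le_div_iff₀ hw0]; linarith [hw.2]
  obtain ⟨uf, ug, uh, uk⟩ := hup α hα w hw y
  obtain ⟨l1, l2⟩ := hlow α w y (hKab α hα).1 (hKab α hα).2 hw0 (by linarith [hw.2])
  have hs := hsq α hα w hw y
  have wp : 0 < w ^ α * ψ α 0 y := by positivity
  have e1 : gauss y ≤ 1 / c * fFun α y w := by
    rw [one_div, le_inv_mul_iff₀ hc]; exact l1
  have fpos : 0 < fFun α y w := lt_of_lt_of_le (by positivity) l1
  have q : 0 < P / gauss 3 := by positivity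
  have e2 : w ^ α * ψ α 0 y ≤ 1 / c * (1 + P / gauss 3) * fFun α y w := by
    rcases le_total |y| 3 with hy | hy
    · have h1 : gauss 3 ≤ gauss y := by
        unfold gauss
        have h9 : y ^ 2 ≤ 3 ^ 2 := sq_le_sq' (by linarith [neg_abs_le y]) (by linarith [le_abs_self y])
        refine mul_le_mul_of_nonneg_left (Real.exp_le_exp.mpr ?_) (by positivity)
        linarith
      calc w ^ α * ψ α 0 y ≤ 1 * P := by gcongr; exact (hps α hα y hy).2
        _ = P / gauss 3 * gauss 3 := by field_simp
        _ ≤ P / gauss 3 * (1 / c * fFun α y w) := by gcongr; exact h1.trans e1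
        _ ≤ (1 + P / gauss 3) * (1 / c * fFun α y w) := by gcongr; linarith
        _ = _ := by ring
    · rw [hψ.eq_tail α (hKsub hα) 0 y hy, pow_zero, mul_one_div]
      have h1 : w ^ α / |y| ^ (α + 1) ≤ 1 / c * fFun α y w := by
        rw [one_div, le_inv_mul_iff₀ hc]; exact l2 (by linarith)
      calc _ ≤ 1 * (1 / c * fFun α y w) := by linarith
        _ ≤ (1 + P / gauss 3) * (1 / c * fFun α y w) := by gcongr; linarith
        _ = _ := by ring
  refine ⟨⟨?_, ?_⟩, ?_, ?_, ?_⟩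
  · rw [one_div, inv_mul_le_iff₀ (by positivity)]
    calc _ ≤ C3 * fFun α y w := by simp only [C3]; linarith
      _ ≤ _ := by gcongr; linarith
  · have := (abs_le.mp uf).2
    calc fFun α y w ≤ 1 * gauss y + C1 * (w ^ α * ψ α 0 y) := by linarith
      _ ≤ (1 + C1 + C2 + C3) * gauss y + (1 + C1 + C2 + C3) * (w ^ α * ψ α 0 y) := by
        gcongr <;> linarith
      _ = _ := by ring
  · have h1 : |gFun α y w| ≤ C1 * w ^ α * ψ α 0 y + (gauss y + y ^ 2 * gauss y) := by
      rw [abs_le] at ug ⊢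
      have : 0 ≤ y ^ 2 * gauss y := by positivity
      constructor <;> nlinarith
    have h2 : gauss y + w ^ α * ψ α 0 y ≤ Real.log (1 / w) * (gauss y + w ^ α * ψ α 0 y) := by
      nlinarith
    set S := gauss y + w ^ α * ψ α 0 y with hS
    set T := Real.log (1 / w) * S
    have hS0 : 0 < S := by positivity
    have hT0 : 0 < T := by positivity
    calc |gFun α y w| ≤ C1 * S + (S + C2 * Real.log (1 / w) * S) := by
          have : C1 * w ^ α * ψ α 0 y ≤ C1 * S := by
            rw [mul_assoc]; gcongr; linarith
          linarith
      _ ≤ C1 * T + (1 * T + C2 * T) := by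
          have : C2 * Real.log (1 / w) * S = C2 * T := by simp only [T]; ring
          rw [this]; gcongr; linarith
      _ ≤ (1 + C1 + C2 + C3) * T := by nlinarith
      _ = _ := by simp only [T]; ring
  · refine uh.trans ?_
    gcongr; linarith
  · refine uk.trans ?_
    gcongr; linarith

end LevyLAN
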